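/- arXiv:2311.06871 — 9 statements merged into one kernel-verified Lean document; each statement's English description precedes it below -/
import Mathlib

section
/- Let g(x) = λ‖x‖₁ on ℝⁿ with λ > 0 and let (x̄, ȳ) ∈ gph ∂g, with J = supp(x̄) and J̄ = {1,…,n} \ J. If (u, ξ) ∈ 𝒯_{gph ∂g}(x̄, ȳ), then for each i ∈ J̄: if ȳᵢ = λ then either (uᵢ > 0 and ξᵢ = 0) or (uᵢ = 0 and ξᵢ ≤ 0); if ȳᵢ = −λ then either (uᵢ < 0 and ξᵢ = 0) or (uᵢ = 0 and ξᵢ ≥ 0); and if |ȳᵢ| < λ then uᵢ = 0. -/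
open Filter Metric Real Set
open scoped InnerProductSpace Topology

/-- The convex subdifferential of a real-valued function `g` at `x`. -/
def RSubdiff {E : Type*} [NormedAddCommGroup E] [InnerProductSpace ℝ E]
    (g : E → ℝ) (x : E) : Set E :=
  {v | ∀ z : E, g x + ⟪v, z - x⟫_ℝ ≤ g z}

/-- The tangent (contingent) cone to a set `S` at `z`:
`w ∈ 𝒯_S(z)` iff there are `τ_k ↓ 0` with `dist (z + τ_k • w) S = o(τ_k)`. -/
def TanCone {E : Type*} [NormedAddCommGroup E] [NormedSpace ℝ E]
    (S : Set E) (z : E) : Set E :=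
  {w | ∃ τ : ℕ → ℝ, (∀ k, 0 < τ k) ∧ Tendsto τ atTop (𝓝 0) ∧
        Tendsto (fun k => Metric.infDist (z + τ k • w) S / τ k) atTop (𝓝 0)}

/-- A tangent direction is the limit of rescaled differences of points of the set. -/
theorem exists_seq_of_mem_tanCone {E : Type*} [NormedAddCommGroup E] [NormedSpace ℝ E]
    {S : Set E} {z w : E} (hS : S.Nonempty) (hw : w ∈ TanCone S z) :
    ∃ (τ : ℕ → ℝ) (v : ℕ → E), (∀ k, 0 < τ k) ∧ Tendsto τ atTop (𝓝 0) ∧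
      (∀ k, z + τ k • v k ∈ S) ∧ Tendsto v atTop (𝓝 w) := by
  obtain ⟨τ, hpos, hτ, hdist⟩ := hw
  have hex (k : ℕ) : ∃ p ∈ S, dist (z + τ k • w) p < infDist (z + τ k • w) S + τ k * τ k :=
    (infDist_lt_iff hS).1 (lt_add_of_pos_right _ (mul_pos (hpos k) (hpos k)))
  choose p hpS hp using hex
  refine ⟨τ, fun k => (τ k)⁻¹ • (p k - z), hpos, hτ, fun k => ?_, ?_⟩
  · rw [smul_inv_smul₀ (hpos k).ne', add_sub_cancel]
    exact hpS k
  · rw [tendsto_iff_dist_tendsto_zero]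
    refine squeeze_zero (fun _ => dist_nonneg) (fun k => ?_) (by simpa using hdist.add hτ)
    have hk := hpos k
    have heq : (τ k)⁻¹ • (p k - z) - w = (τ k)⁻¹ • (p k - (z + τ k • w)) := by
      rw [← sub_sub, smul_sub _ _ (τ k • w), inv_smul_smul₀ hk.ne']
    rw [dist_eq_norm, heq, norm_smul, norm_inv, Real.norm_of_nonneg hk.le, ← dist_eq_norm,
      dist_comm, inv_mul_eq_div, div_le_iff₀ hk, add_mul, div_mul_cancel₀ _ hk.ne']
    exact (hp k).le

/-- The coordinatewise subgradient inequality for `lam * ‖·‖₁`. -/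
theorem add_mul_le_of_mem_rSubdiff_l1 {n : ℕ} {lam : ℝ} {g : EuclideanSpace ℝ (Fin n) → ℝ}
    (hg : ∀ z, g z = lam * ∑ i, |z i|) {a b : EuclideanSpace ℝ (Fin n)}
    (h : b ∈ RSubdiff g a) (i : Fin n) (t : ℝ) :
    lam * |a i| + b i * t ≤ lam * |a i + t| := by
  have h1 := h (a + EuclideanSpace.single i t)
  have hsum : ∑ j, |(a + EuclideanSpace.single i t) j| = ∑ j, |a j| + (|a i + t| - |a i|) := by
    rw [← sub_eq_iff_eq_add', ← Finset.sum_sub_distrib, Finset.sum_eq_single i]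
    · simp
    · intro j _ hj
      simp [hj]
    · simp
  rw [hg, hg, hsum, add_sub_cancel_left, EuclideanSpace.inner_single_right] at h1
  simp only [conj_trivial] at h1
  linarith

theorem abs_le_of_mem_rSubdiff_l1 {n : ℕ} {lam : ℝ} (hlam : 0 < lam)
    {g : EuclideanSpace ℝ (Fin n) → ℝ}
    (hg : ∀ z, g z = lam * ∑ i, |z i|) {a b : EuclideanSpace ℝ (Fin n)}
    (h : b ∈ RSubdiff g a) (i : Fin n) : |b i| ≤ lam := by
  have h1 := add_mul_le_of_mem_rSubdiff_l1 hg h i 1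
  have h2 := add_mul_le_of_mem_rSubdiff_l1 hg h i (-1)
  have h3 := mul_le_mul_of_nonneg_left (abs_add_le (a i) 1) hlam.le
  have h4 := mul_le_mul_of_nonneg_left (abs_add_le (a i) (-1)) hlam.le
  simp only [abs_neg, abs_one] at h3 h4
  exact abs_le.2 ⟨by linarith, by linarith⟩

theorem mul_eq_of_mem_rSubdiff_l1 {n : ℕ} {lam : ℝ} {g : EuclideanSpace ℝ (Fin n) → ℝ}
    (hg : ∀ z, g z = lam * ∑ i, |z i|) {a b : EuclideanSpace ℝ (Fin n)}
    (h : b ∈ RSubdiff g a) (i : Fin n) : b i * a i = lam * |a i| := by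
  have h1 := add_mul_le_of_mem_rSubdiff_l1 hg h i (-a i)
  have h2 := add_mul_le_of_mem_rSubdiff_l1 hg h i (a i)
  rw [add_neg_cancel, abs_zero] at h1
  rw [← two_mul, abs_mul, abs_two] at h2
  linarith

/-- The scalar case of the tangent cone at a point `(0, lam)` of `gph ∂(lam * |·|)`. -/
theorem pos_and_eq_zero_or_of_tendsto {lam u ξ : ℝ} (hlam : 0 < lam) {τ c d : ℕ → ℝ}
    (hτ : ∀ k, 0 < τ k) (hc : Tendsto c atTop (𝓝 u)) (hd : Tendsto d atTop (𝓝 ξ))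
    (hle : ∀ k, lam + τ k * d k ≤ lam) (hmul : ∀ k, (lam + τ k * d k) * c k = lam * |c k|)
    (hu : lam * u = lam * |u|) : (0 < u ∧ ξ = 0) ∨ (u = 0 ∧ ξ ≤ 0) := by
  have hu0 : 0 ≤ u := abs_eq_self.1 (mul_left_cancel₀ hlam.ne' hu).symm
  rcases hu0.eq_or_lt with h | h
  · refine Or.inr ⟨h.symm, le_of_tendsto' hd fun k => ?_⟩
    exact nonpos_of_mul_nonpos_right (by linarith [hle k]) (hτ k)
  · refine Or.inl ⟨h, tendsto_nhds_unique hd (tendsto_const_nhds.congr' ?_)⟩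
    filter_upwards [hc.eventually_const_lt h] with k hk
    have h1 := hmul k
    rw [abs_of_pos hk] at h1
    have h2 : τ k * d k = 0 := by linarith [mul_right_cancel₀ hk.ne' h1]
    exact ((mul_eq_zero.1 h2).resolve_left (hτ k).ne').symm

/-- Corollary 2.1(i): description of the tangent cone to `gph ∂g` for `g = λ‖·‖₁`. -/
theorem tangent_cone_gph_subdiff_l1 {n : ℕ}
    (lam : ℝ) (hlam : 0 < lam)
    (g : EuclideanSpace ℝ (Fin n) → ℝ) (hg : ∀ z, g z = lam * ∑ i, |z i|)
    (xb yb : EuclideanSpace ℝ (Fin n))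
    (hxy : yb ∈ RSubdiff g xb)
    (u ξ : EuclideanSpace ℝ (Fin n))
    (htan : ((u, ξ) : EuclideanSpace ℝ (Fin n) × EuclideanSpace ℝ (Fin n)) ∈
      TanCone {p : EuclideanSpace ℝ (Fin n) × EuclideanSpace ℝ (Fin n) |
        p.2 ∈ RSubdiff g p.1} (xb, yb)) :
    ∀ i : Fin n, xb i = 0 →
      (yb i = lam → (0 < u i ∧ ξ i = 0) ∨ (u i = 0 ∧ ξ i ≤ 0)) ∧
      (yb i = -lam → (u i < 0 ∧ ξ i = 0) ∨ (u i = 0 ∧ 0 ≤ ξ i)) ∧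
      (|yb i| < lam → u i = 0) := by
  obtain ⟨τ, v, hpos, hτ, hS, hv⟩ := exists_seq_of_mem_tanCone ⟨(xb, yb), hxy⟩ htan
  intro i hi
  have hc : Tendsto (fun k => (v k).1 i) atTop (𝓝 (u i)) :=
    (((EuclideanSpace.proj (𝕜 := ℝ) i).continuous.comp continuous_fst).tendsto (u, ξ)).comp hv
  have hd : Tendsto (fun k => (v k).2 i) atTop (𝓝 (ξ i)) :=
    (((EuclideanSpace.proj (𝕜 := ℝ) i).continuous.comp continuous_snd).tendsto (u, ξ)).comp hv
  have habs (k : ℕ) : |yb i + τ k * (v k).2 i| ≤ lam :=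
    abs_le_of_mem_rSubdiff_l1 hlam hg (hS k) i
  have hmul (k : ℕ) : (yb i + τ k * (v k).2 i) * (v k).1 i = lam * |(v k).1 i| := by
    have h : (yb i + τ k * (v k).2 i) * (xb i + τ k * (v k).1 i) =
        lam * |xb i + τ k * (v k).1 i| := mul_eq_of_mem_rSubdiff_l1 hg (hS k) i
    rw [hi, zero_add, abs_mul, abs_of_pos (hpos k)] at h
    exact mul_left_cancel₀ (hpos k).ne' (by linarith)
  have hu : yb i * u i = lam * |u i| := by
    have hl := ((hτ.mul hd).const_add (yb i)).mul hc
    rw [zero_mul, add_zero] at hl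
    exact tendsto_nhds_unique (hl.congr hmul) (hc.abs.const_mul lam)
  refine ⟨fun hy => ?_, fun hy => ?_, fun hy => ?_⟩
  · rw [hy] at habs hmul hu
    exact pos_and_eq_zero_or_of_tendsto hlam hpos hc hd (fun k => (abs_le.1 (habs k)).2) hmul hu
  · rw [hy] at habs hmul hu
    have h := pos_and_eq_zero_or_of_tendsto hlam hpos hc.neg hd.neg
      (fun k => by linarith [(abs_le.1 (habs k)).1])
      (fun k => by rw [abs_neg]; linarith [hmul k]) (by rw [abs_neg]; linarith)
    simpa only [neg_pos, neg_eq_zero, neg_nonpos] using h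
  · have h1 : yb i * u i ≤ |yb i| * |u i| := abs_mul (yb i) (u i) ▸ le_abs_self _
    by_contra hne
    nlinarith [abs_pos.2 hne]
end

section
/- Let g(x) = λ‖x‖₁ on ℝⁿ with λ > 0 and let (x̄, ȳ) ∈ gph ∂g, with J = supp(x̄) and J̄ = {1,…,n} \ J. Then (u, ξ) ∈ N̂_{gph ∂g}(x̄, ȳ) if and only if uᵢ = 0 for every i ∈ J, and for each i ∈ J̄: if |ȳᵢ| = λ then sign(ȳᵢ)·uᵢ ≤ 0 and sign(ȳᵢ)·ξᵢ ≥ 0, while if |ȳᵢ| < λ then ξᵢ = 0. -/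
open Filter Metric Real Set
open scoped InnerProductSpace Topology

/-- The regular (Fréchet) normal cone to a set `S ⊆ E × E` at `z ∈ S`, with respect to the
inner product `⟪(a,b),(c,d)⟫ = ⟪a,c⟫ + ⟪b,d⟫` and its induced (ℓ²) norm on the product:
`v ∈ N̂_S(z)` iff `limsup_{S ∋ w → z, w ≠ z} ⟪v, w - z⟫ / ‖w - z‖ ≤ 0`. -/
def RegNormalCone2 {E : Type*} [NormedAddCommGroup E] [InnerProductSpace ℝ E]
    (S : Set (E × E)) (z : E × E) : Set (E × E) :=
  {v | ∀ ε : ℝ, 0 < ε → ∃ δ : ℝ, 0 < δ ∧ ∀ w ∈ S, w ≠ z →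
      Real.sqrt (‖w.1 - z.1‖ ^ 2 + ‖w.2 - z.2‖ ^ 2) < δ →
      ⟪v.1, w.1 - z.1⟫_ℝ + ⟪v.2, w.2 - z.2⟫_ℝ ≤
        ε * Real.sqrt (‖w.1 - z.1‖ ^ 2 + ‖w.2 - z.2‖ ^ 2)}

/-- Regular normals make a nonpositive inner product with every feasible direction. -/
theorem RegNormalCone2.inner_le_zero {E : Type*} [NormedAddCommGroup E] [InnerProductSpace ℝ E]
    {S : Set (E × E)} {z v : E × E} (hv : v ∈ RegNormalCone2 S z) (d : E × E)
    {r₀ : ℝ} (hr₀ : 0 < r₀) (hd : ∀ r, 0 < r → r < r₀ → z + r • d ∈ S) :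
    ⟪v.1, d.1⟫_ℝ + ⟪v.2, d.2⟫_ℝ ≤ 0 := by
  rcases eq_or_ne d 0 with rfl | hd0
  · simp
  set N := Real.sqrt (‖d.1‖ ^ 2 + ‖d.2‖ ^ 2)
  have hN0 : 0 ≤ N := Real.sqrt_nonneg _
  have key : ∀ ε, 0 < ε → ⟪v.1, d.1⟫_ℝ + ⟪v.2, d.2⟫_ℝ ≤ ε * N := by
    intro ε hε
    obtain ⟨δ, hδ, h⟩ := hv ε hε
    obtain ⟨r, hr, hr'⟩ := exists_between (lt_min hr₀ (div_pos hδ (by positivity : 0 < N + 1)))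
    have hrδ : r * (N + 1) < δ := (lt_div_iff₀ (by positivity)).1 (hr'.trans_le (min_le_right _ _))
    have hsqrt : Real.sqrt (‖(z + r • d).1 - z.1‖ ^ 2 + ‖(z + r • d).2 - z.2‖ ^ 2) = r * N := by
      have : ‖(z + r • d).1 - z.1‖ ^ 2 + ‖(z + r • d).2 - z.2‖ ^ 2
          = r ^ 2 * (‖d.1‖ ^ 2 + ‖d.2‖ ^ 2) := by
        simp [norm_smul, mul_pow]
        ring
      rw [this, Real.sqrt_mul (sq_nonneg r), Real.sqrt_sq hr.le]
    have hw := h (z + r • d) (hd r hr (hr'.trans_le (min_le_left _ _)))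
      (by simp [hr.ne', hd0]) (by rw [hsqrt]; linarith)
    rw [hsqrt] at hw
    simp only [Prod.fst_add, Prod.snd_add, Prod.smul_fst, Prod.smul_snd, add_sub_cancel_left,
      real_inner_smul_right] at hw
    have : r * (⟪v.1, d.1⟫_ℝ + ⟪v.2, d.2⟫_ℝ) ≤ r * (ε * N) := by linarith
    exact le_of_mul_le_mul_left this hr
  refine le_of_forall_pos_le_add fun η hη => ?_
  have := key (η / (N + 1)) (by positivity)
  have h2 : η / (N + 1) * N ≤ η := by
    rw [div_mul_eq_mul_div, div_le_iff₀ (by positivity)]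
    nlinarith
  linarith

/-- The subdifferential of `lam * ‖·‖₁` acts coordinatewise. -/
theorem mem_rSubdiff_l1_iff {n : ℕ} {lam : ℝ} (hlam : 0 ≤ lam)
    {g : EuclideanSpace ℝ (Fin n) → ℝ} (hg : ∀ z, g z = lam * ∑ i, |z i|)
    (x y : EuclideanSpace ℝ (Fin n)) :
    y ∈ RSubdiff g x ↔ ∀ i, |y i| ≤ lam ∧ y i * x i = lam * |x i| := by
  constructor
  · intro h i
    have key : ∀ t : ℝ, lam * |x i| + y i * t ≤ lam * |x i + t| := by
      intro t
      have ht := h (x + EuclideanSpace.single i t)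
      rw [hg, hg, add_sub_cancel_left, EuclideanSpace.inner_single_right,
        ← Finset.add_sum_erase _ _ (Finset.mem_univ i),
        ← Finset.add_sum_erase _ (fun j => |(x + EuclideanSpace.single i t) j|)
          (Finset.mem_univ i)] at ht
      have hsum : ∑ j ∈ Finset.univ.erase i, |(x + EuclideanSpace.single i t) j|
          = ∑ j ∈ Finset.univ.erase i, |x j| :=
        Finset.sum_congr rfl fun j hj => by simp [Finset.ne_of_mem_erase hj]
      rw [hsum] at ht
      simp at ht
      linarith
    have hle : ∀ t : ℝ, y i * t ≤ lam * |t| := by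
      intro t
      have := mul_le_mul_of_nonneg_left (abs_add_le (x i) t) hlam
      linarith [key t]
    have h1 := hle 1
    have h2 := hle (-1)
    have h3 := key (-x i)
    simp at h1 h2 h3
    exact ⟨abs_le.2 ⟨by linarith, h1⟩, le_antisymm (hle _) h3⟩
  · intro h z
    rw [hg, hg, PiLp.inner_apply, Finset.mul_sum, Finset.mul_sum, ← Finset.sum_add_distrib]
    refine Finset.sum_le_sum fun i _ => ?_
    obtain ⟨h1, h2⟩ := h i
    have h3 : y i * z i ≤ lam * |z i| :=
      (le_abs_self _).trans (by rw [abs_mul]; gcongr)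
    simp
    linarith

/-- Near a point of the graph of the subdifferential of `lam * |·|`, the sign conditions on `(u, ξ)`
make it polar to all displacements within the graph. -/
theorem exists_pos_forall_polar_abs {lam x y u ξ : ℝ} (hlam : 0 < lam) (hy : |y| ≤ lam)
    (hyx : y * x = lam * |x|) (hx0 : x ≠ 0 → u = 0)
    (hx : x = 0 → (|y| = lam → Real.sign y * u ≤ 0 ∧ 0 ≤ Real.sign y * ξ) ∧
      (|y| < lam → ξ = 0)) :
    ∃ δ > 0, ∀ a b : ℝ, |b| ≤ lam → b * a = lam * |a| → |a - x| < δ → |b - y| < δ →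
      u * (a - x) + ξ * (b - y) ≤ 0 := by
  rcases eq_or_ne x 0 with rfl | hne
  · obtain ⟨h1, h2⟩ := hx rfl
    rcases hy.lt_or_eq with hlt | heq
    · refine ⟨lam - |y|, by linarith, fun a b hb hba ha hby => ?_⟩
      have hb' : |b| < lam := by
        have := abs_sub_abs_le_abs_sub b y
        linarith
      have ha0 : a = 0 := by
        by_contra hne
        have := mul_lt_mul_of_pos_right hb' (abs_pos.2 hne)
        have := le_abs_self (b * a)
        rw [abs_mul] at this
        linarith
      simp [h2 hlt, ha0]
    · obtain ⟨hu, hξ⟩ := h1 heq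
      refine ⟨lam, hlam, fun a b hb hba _ hby => ?_⟩
      rw [abs_lt] at hby
      rw [abs_le] at hb
      have ha : 0 ≤ b * a := hba ▸ by positivity
      rcases abs_choice y with hy' | hy'
      · have hy0 : 0 < y := by linarith
        rw [Real.sign_of_pos hy0] at hu hξ
        have : 0 ≤ a := nonneg_of_mul_nonneg_right ha (by linarith)
        nlinarith
      · have hy0 : y < 0 := by linarith
        rw [Real.sign_of_neg hy0] at hu hξ
        have : a ≤ 0 := nonpos_of_mul_nonneg_right ha (by linarith)
        nlinarith
  · refine ⟨|x|, abs_pos.2 hne, fun a b _ hba ha _ => ?_⟩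
    have hb : b = y := by
      rw [abs_lt] at ha
      rcases hne.lt_or_gt with hx | hx
      · rw [abs_of_neg hx] at ha hyx
        have ha0 : a < 0 := by linarith
        rw [abs_of_neg ha0] at hba
        have e1 : b = -lam := mul_right_cancel₀ ha0.ne (by linarith)
        have e2 : y = -lam := mul_right_cancel₀ hx.ne (by linarith)
        rw [e1, e2]
      · rw [abs_of_pos hx] at ha hyx
        have ha0 : 0 < a := by linarith
        rw [abs_of_pos ha0] at hba
        rw [mul_right_cancel₀ ha0.ne' hba, mul_right_cancel₀ hx.ne' hyx]
    simp [hx0 hne, hb]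

/-- Corollary 2.1(ii): description of the regular normal cone to `gph ∂g` for `g = λ‖·‖₁`. -/
theorem regular_normal_cone_gph_subdiff_l1 {n : ℕ}
    (lam : ℝ) (hlam : 0 < lam)
    (g : EuclideanSpace ℝ (Fin n) → ℝ) (hg : ∀ z, g z = lam * ∑ i, |z i|)
    (xb yb : EuclideanSpace ℝ (Fin n))
    (hxy : yb ∈ RSubdiff g xb)
    (u ξ : EuclideanSpace ℝ (Fin n)) :
    ((u, ξ) : EuclideanSpace ℝ (Fin n) × EuclideanSpace ℝ (Fin n)) ∈
        RegNormalCone2 {p : EuclideanSpace ℝ (Fin n) × EuclideanSpace ℝ (Fin n) |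
          p.2 ∈ RSubdiff g p.1} (xb, yb) ↔
      (∀ i : Fin n, xb i ≠ 0 → u i = 0) ∧
      ∀ i : Fin n, xb i = 0 →
        (|yb i| = lam → Real.sign (yb i) * u i ≤ 0 ∧ 0 ≤ Real.sign (yb i) * ξ i) ∧
        (|yb i| < lam → ξ i = 0) := by
  simp only [mem_rSubdiff_l1_iff hlam.le hg] at hxy ⊢
  constructor
  · intro hN
    have key : ∀ (i : Fin n) (s t r₀ : ℝ), 0 < r₀ →
        (∀ r, 0 < r → r < r₀ → |yb i + r * t| ≤ lam ∧
          (yb i + r * t) * (xb i + r * s) = lam * |xb i + r * s|) →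
        u i * s + ξ i * t ≤ 0 := by
      intro i s t r₀ hr₀ h
      have := RegNormalCone2.inner_le_zero hN
        (EuclideanSpace.single i s, EuclideanSpace.single i t) hr₀ (fun r hr hr' j => by
          rcases eq_or_ne j i with rfl | hj
          · simpa using h r hr hr'
          · simpa [hj] using hxy j)
      simpa [EuclideanSpace.inner_single_right, mul_comm] using this
    refine ⟨fun i hi => ?_, fun i hi => ⟨fun hy => ?_, fun hy => ?_⟩⟩
    · obtain ⟨h1, h2⟩ := hxy i
      have hc : ∀ c : ℝ, |c| ≤ 1 → u i * (c * xb i) ≤ 0 := by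
        intro c hc
        have := key i (c * xb i) 0 1 one_pos (fun r hr hr' => by
          have hpos : 0 ≤ 1 + r * c := by nlinarith [(abs_le.1 hc).1]
          have e : xb i + r * (c * xb i) = (1 + r * c) * xb i := by ring
          rw [e, abs_mul, abs_of_nonneg hpos, mul_zero, add_zero]
          exact ⟨h1, by linear_combination (1 + r * c) * h2⟩)
        simpa using this
      have hp := hc 1 (by simp)
      have hm := hc (-1) (by simp)
      have : u i * xb i = 0 := by linarith
      exact (mul_eq_zero.1 this).resolve_right hi
    · have hy0 : yb i ≠ 0 := fun h => by simp [h] at hy; linarith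
      have hu := key i (yb i) 0 1 one_pos (fun r hr _ => by
        rw [hi, mul_zero, add_zero, zero_add, abs_mul, abs_of_pos hr, hy]
        refine ⟨le_rfl, ?_⟩
        have : yb i * yb i = lam * lam := by rw [← abs_mul_abs_self, hy]
        linear_combination r * this)
      have hξ := key i 0 (-yb i) 1 one_pos (fun r hr hr' => by
        have e : yb i + r * -yb i = (1 - r) * yb i := by ring
        rw [hi, e, abs_mul, abs_of_pos (by linarith : 0 < 1 - r), hy]
        exact ⟨by nlinarith, by simp⟩)
      rcases hy0.lt_or_gt with h | h
      · rw [Real.sign_of_neg h]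
        constructor <;> nlinarith
      · rw [Real.sign_of_pos h]
        constructor <;> nlinarith
    · have hc : ∀ c : ℝ, |c| = 1 → ξ i * c ≤ 0 := by
        intro c hc
        have := key i 0 c (lam - |yb i|) (by linarith) (fun r hr hr' => by
          refine ⟨(abs_add_le _ _).trans ?_, by simp [hi]⟩
          rw [abs_mul, hc, abs_of_pos hr]
          linarith)
        simpa using this
      have hp := hc 1 (by simp)
      have hm := hc (-1) (by simp)
      linarith
  · rintro ⟨hJ, hJc⟩ ε hε
    have hloc := fun i => exists_pos_forall_polar_abs hlam (hxy i).1 (hxy i).2 (hJ i) (hJc i)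
    choose D hD hloc using hloc
    obtain ⟨δ, hδ, hδD⟩ : ∃ δ > 0, ∀ i, δ < D i :=
      ((eventually_mem_nhdsWithin (a := (0 : ℝ)) (s := Ioi 0)).and
        (eventually_all.2 fun i => nhdsWithin_le_nhds (Iio_mem_nhds (hD i)))).exists
    refine ⟨δ, hδ, fun w hw _ hwδ => ?_⟩
    refine le_trans ?_ (by positivity : 0 ≤ ε * _)
    rw [PiLp.inner_apply, PiLp.inner_apply, ← Finset.sum_add_distrib]
    refine Finset.sum_nonpos fun i _ => ?_
    have h1 : |w.1 i - xb i| < D i := calc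
      _ ≤ ‖w.1 - xb‖ := PiLp.norm_apply_le (w.1 - xb) i
      _ ≤ _ := Real.le_sqrt_of_sq_le (le_add_of_nonneg_right (sq_nonneg _))
      _ < D i := hwδ.trans (hδD i)
    have h2 : |w.2 i - yb i| < D i := calc
      _ ≤ ‖w.2 - yb‖ := PiLp.norm_apply_le (w.2 - yb) i
      _ ≤ _ := Real.le_sqrt_of_sq_le (le_add_of_nonneg_left (sq_nonneg _))
      _ < D i := hwδ.trans (hδD i)
    simpa [mul_comm] using hloc i (w.1 i) (w.2 i) (hw i).1 (hw i).2 h1 h2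
end

section
/- Let f : ℝⁿ → ℝ be twice continuously differentiable, g(x) = λ‖x‖₁ with λ > 0, and let x̄ ∈ 𝒮* with J = supp(x̄) and J̄ = {1,…,n} \ J. Suppose either (a) |[∇f(x̄)]ᵢ| < λ for every i ∈ J̄, and every (u, −∇²f(x̄)u) ∈ 𝒯_{gph ∂g}(x̄, −∇f(x̄)) satisfies u_J = 0; or (b) ∇²f(x̄) − I and the principal submatrix [∇²f(x̄)]_{JJ} are nonsingular and |[∇f(x̄)]ᵢ| < λ for every i ∈ J̄. Then a local Lipschitzian error bound holds at x̄: there exist κ > 0 and δ > 0 such that dist(x, 𝒮*) ≤ κ · r(x) for all x ∈ B(x̄, δ). -/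
open Filter Metric Real Set
open scoped InnerProductSpace Topology

/-- Membership in the subdifferential of `lam * ‖·‖₁`, coordinate by coordinate. -/
theorem mem_RSubdiff_l1_iff {n : ℕ} {lam : ℝ} {g : EuclideanSpace ℝ (Fin n) → ℝ}
    (hg : ∀ z, g z = lam * ∑ i, |z i|) (x v : EuclideanSpace ℝ (Fin n)) :
    v ∈ RSubdiff g x ↔ ∀ i, |v i| ≤ lam ∧ v i * x i = lam * |x i| := by
  have hinner : ∀ z : EuclideanSpace ℝ (Fin n), ⟪v, z - x⟫_ℝ = ∑ i, v i * (z i - x i) := by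
    intro z
    simp [PiLp.inner_apply, mul_comm]
  simp only [RSubdiff, mem_ofPred_eq, hinner, hg, Finset.mul_sum, ← Finset.sum_add_distrib]
  refine ⟨fun h i => ?_, fun h z => Finset.sum_le_sum fun i _ => ?_⟩
  · have key : ∀ t : ℝ, v i * t ≤ lam * (|x i + t| - |x i|) := by
      intro t
      have h1 := h (x + EuclideanSpace.single i t)
      rw [← sub_nonneg, ← Finset.sum_sub_distrib, Finset.sum_eq_single i] at h1
      · simp at h1
        linarith
      · intro j _ hj
        simp [hj]
      · simp
    have hx : v i * x i = lam * |x i| := by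
      have h1 := key (x i)
      have h2 := key (-x i)
      rw [← two_mul, abs_mul, abs_two] at h1
      rw [add_neg_cancel, abs_zero] at h2
      linarith
    refine ⟨abs_le.2 ⟨?_, ?_⟩, hx⟩
    · have h1 := key (-1 - x i)
      rw [add_sub_cancel, abs_neg, abs_one] at h1
      linarith
    · have h1 := key (1 - x i)
      rw [add_sub_cancel, abs_one] at h1
      linarith
  · obtain ⟨h1, h2⟩ := h i
    have h3 : v i * z i ≤ lam * |z i| :=
      (le_abs_self _).trans (abs_mul (v i) (z i) ▸ mul_le_mul_of_nonneg_right h1 (abs_nonneg _))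
    linarith

/-- A point satisfying the optimality condition of the proximal problem is its minimizer. -/
theorem eq_of_sub_mem_RSubdiff {E : Type*} [NormedAddCommGroup E] [InnerProductSpace ℝ E]
    {g : E → ℝ} {w p q : E} (hq : w - q ∈ RSubdiff g q)
    (hp : 1/2 * ‖p - w‖ ^ 2 + g p ≤ 1/2 * ‖q - w‖ ^ 2 + g q) : p = q := by
  have h1 := hq p
  have h2 : ‖p - w‖ ^ 2 = ‖p - q‖ ^ 2 - 2 * ⟪w - q, p - q⟫_ℝ + ‖q - w‖ ^ 2 := by
    rw [norm_sub_rev q w, real_inner_comm, ← norm_sub_sq_real]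
    congr 2
    abel
  have h3 : ‖p - q‖ ^ 2 ≤ 0 := by linarith
  simpa [sub_eq_zero] using le_antisymm h3 (sq_nonneg _)

theorem mul_eq_mul_abs_of_mul_pos {c v x y : ℝ} (h : v * x = c * |x|) (hxy : 0 < x * y) :
    v * y = c * |y| := by
  rcases mul_pos_iff.1 hxy with ⟨hx, hy⟩ | ⟨hx, hy⟩
  · rw [abs_of_pos hx] at h
    rw [abs_of_pos hy, mul_right_cancel₀ hx.ne' h]
  · rw [abs_of_neg hx, mul_neg, ← neg_mul] at h
    rw [abs_of_neg hy, mul_right_cancel₀ hx.ne h, neg_mul, mul_neg]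

theorem mem_TanCone_of_eventually_mem {E : Type*} [NormedAddCommGroup E] [NormedSpace ℝ E]
    {S : Set E} {z w : E} (h : ∀ᶠ t : ℝ in 𝓝 0, z + t • w ∈ S) : w ∈ TanCone S z := by
  have hτ : Tendsto (fun k : ℕ => 1 / ((k : ℝ) + 1)) atTop (𝓝 0) :=
    tendsto_one_div_add_atTop_nhds_zero_nat
  refine ⟨_, fun k => by positivity, hτ, ?_⟩
  refine tendsto_const_nhds.congr' ?_
  filter_upwards [hτ.eventually h] with k hk
  rw [Metric.infDist_zero_of_mem hk, zero_div]

/-- The coordinate projection of `EuclideanSpace ℝ (Fin n)` onto the support of `x`. -/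
noncomputable def suppProj {n : ℕ} (x : EuclideanSpace ℝ (Fin n)) :
    EuclideanSpace ℝ (Fin n) →L[ℝ] EuclideanSpace ℝ (Fin n) :=
  LinearMap.toContinuousLinearMap
    { toFun := fun u => WithLp.toLp 2 fun i => if x i = 0 then 0 else u i
      map_add' := fun u v => by ext i; by_cases h : x i = 0 <;> simp [h]
      map_smul' := fun c u => by ext i; by_cases h : x i = 0 <;> simp [h] }

theorem suppProj_apply {n : ℕ} (x u : EuclideanSpace ℝ (Fin n)) (i : Fin n) :
    suppProj x u i = if x i = 0 then 0 else u i := rfl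

/-- Under strict complementarity, small perturbations of a point of the graph of the
subdifferential of `lam * ‖·‖₁` that keep the zero pattern of the first component and the values
of the second component on the support stay in the graph. -/
theorem mem_RSubdiff_l1_of_perturb {n : ℕ} {lam : ℝ} {g : EuclideanSpace ℝ (Fin n) → ℝ}
    (hg : ∀ z, g z = lam * ∑ i, |z i|) {x v y w : EuclideanSpace ℝ (Fin n)}
    (hv : v ∈ RSubdiff g x)
    (hzero : ∀ i, x i = 0 → y i = 0 ∧ |w i| ≤ lam)
    (hsupp : ∀ i, x i ≠ 0 → 0 < x i * y i ∧ w i = v i) : w ∈ RSubdiff g y := by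
  rw [mem_RSubdiff_l1_iff hg] at hv ⊢
  intro i
  by_cases hi : x i = 0
  · obtain ⟨hy, hw⟩ := hzero i hi
    simp [hy, hw]
  · obtain ⟨hy, hw⟩ := hsupp i hi
    rw [hw]
    exact ⟨(hv i).1, mul_eq_mul_abs_of_mul_pos (hv i).2 hy⟩

/-- Under strict complementarity the tangent cone to the graph contains all directions that vanish
off the support in the first component and on the support in the second one. -/
theorem mem_TanCone_graph_RSubdiff_l1 {n : ℕ} {lam : ℝ} {g : EuclideanSpace ℝ (Fin n) → ℝ}
    (hg : ∀ z, g z = lam * ∑ i, |z i|) {x v u w : EuclideanSpace ℝ (Fin n)}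
    (hv : v ∈ RSubdiff g x) (hstrict : ∀ i, x i = 0 → |v i| < lam)
    (hu : ∀ i, x i = 0 → u i = 0) (hw : ∀ i, x i ≠ 0 → w i = 0) :
    (u, w) ∈ TanCone {p : EuclideanSpace ℝ (Fin n) × EuclideanSpace ℝ (Fin n) |
      p.2 ∈ RSubdiff g p.1} (x, v) := by
  refine mem_TanCone_of_eventually_mem ?_
  have hsmall : ∀ᶠ t : ℝ in 𝓝 0, ∀ i, x i = 0 → |v i + t * w i| < lam := by
    refine eventually_all.2 fun i => ?_
    by_cases hi : x i = 0
    · have hc : Continuous fun t : ℝ => |v i + t * w i| := by fun_prop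
      filter_upwards [hc.continuousAt.eventually_lt (continuousAt_const (y := lam))
        (by simpa using hstrict i hi)] with t ht _ using ht
    · exact Eventually.of_forall fun t h => absurd h hi
  have hsign : ∀ᶠ t : ℝ in 𝓝 0, ∀ i, x i ≠ 0 → 0 < x i * (x i + t * u i) := by
    refine eventually_all.2 fun i => ?_
    by_cases hi : x i = 0
    · exact Eventually.of_forall fun t h => absurd hi h
    · have hc : Continuous fun t : ℝ => x i * (x i + t * u i) := by fun_prop
      filter_upwards [(continuousAt_const (y := (0 : ℝ))).eventually_lt hc.continuousAt
        (by simpa using hi)] with t ht _ using ht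
  filter_upwards [hsmall, hsign] with t h1 h2
  refine mem_RSubdiff_l1_of_perturb hg hv (fun i hi => ⟨?_, ?_⟩) (fun i hi => ⟨?_, ?_⟩)
  · simp [hi, hu i hi]
  · simpa using (h1 i hi).le
  · simpa using h2 i hi
  · simp [hw i hi]

/-- Near a strictly complementary stationary point the residual map is `z ↦ z` off the support
and `z ↦ F z - F x` on the support. -/
theorem eventually_sub_prox_l1_eq {n : ℕ} {lam : ℝ} {g : EuclideanSpace ℝ (Fin n) → ℝ}
    (hg : ∀ z, g z = lam * ∑ i, |z i|)
    {F proxg : EuclideanSpace ℝ (Fin n) → EuclideanSpace ℝ (Fin n)}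
    (hproxg : ∀ w z : EuclideanSpace ℝ (Fin n),
        1/2 * ‖proxg w - w‖ ^ 2 + g (proxg w) ≤ 1/2 * ‖z - w‖ ^ 2 + g z)
    {x : EuclideanSpace ℝ (Fin n)} (hF : ContinuousAt F x) (hx : -F x ∈ RSubdiff g x)
    (hstrict : ∀ i, x i = 0 → |F x i| < lam) :
    ∀ᶠ z in 𝓝 x, z - proxg (z - F z) = z - suppProj x z + suppProj x (F z - F x) := by
  have hFi : ∀ i, ContinuousAt (fun z => F z i) x := fun i =>
    (PiLp.continuous_apply 2 (fun _ : Fin n => ℝ) i).continuousAt.comp hF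
  have hzi : ∀ i, ContinuousAt (fun z : EuclideanSpace ℝ (Fin n) => z i) x := fun i =>
    (PiLp.continuous_apply 2 (fun _ : Fin n => ℝ) i).continuousAt
  have hsmall : ∀ᶠ z in 𝓝 x, ∀ i, x i = 0 → |z i - F z i| < lam := by
    refine eventually_all.2 fun i => ?_
    by_cases hi : x i = 0
    · filter_upwards [((hzi i).sub (hFi i)).abs.eventually_lt (continuousAt_const (y := lam))
        (by simpa [hi] using hstrict i hi)] with z hz _ using hz
    · exact Eventually.of_forall fun t h => absurd h hi
  have hsign : ∀ᶠ z in 𝓝 x, ∀ i, x i ≠ 0 → 0 < x i * (z i - (F z i - F x i)) := by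
    refine eventually_all.2 fun i => ?_
    by_cases hi : x i = 0
    · exact Eventually.of_forall fun t h => absurd hi h
    · have hc : ContinuousAt (fun z => x i * (z i - (F z i - F x i))) x :=
        continuousAt_const.mul ((hzi i).sub ((hFi i).sub continuousAt_const))
      filter_upwards [(continuousAt_const (y := (0 : ℝ))).eventually_lt hc
        (by simpa using hi)] with z hz _ using hz
  filter_upwards [hsmall, hsign] with z h1 h2
  have hprox : proxg (z - F z) = suppProj x z - suppProj x (F z - F x) := by
    refine eq_of_sub_mem_RSubdiff ?_ (hproxg _ _)
    refine mem_RSubdiff_l1_of_perturb hg hx (fun i hi => ⟨?_, ?_⟩) (fun i hi => ⟨?_, ?_⟩)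
    · simp [suppProj_apply, hi]
    · simpa [suppProj_apply, hi] using (h1 i hi).le
    · simpa [suppProj_apply, hi] using h2 i hi
    · simp [suppProj_apply, hi]
  rw [hprox]
  abel

/-- A map with injective derivative at a point expands distances to that point, up to a constant
factor. -/
theorem HasFDerivAt.exists_norm_sub_le_of_injective {E F : Type*} [NormedAddCommGroup E]
    [NormedSpace ℝ E] [FiniteDimensional ℝ E] [NormedAddCommGroup F] [NormedSpace ℝ F]
    {G : E → F} {D : E →L[ℝ] F} {x : E} (hG : HasFDerivAt G D x)
    (hD : ∀ u, D u = 0 → u = 0) :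
    ∃ κ : ℝ, 0 < κ ∧ ∀ᶠ z in 𝓝 x, ‖z - x‖ ≤ κ * ‖G z - G x‖ := by
  have hD' : Topology.IsInducing D :=
    (LinearMap.isClosedEmbedding_of_injective (f := D.toLinearMap)
      (LinearMap.ker_eq_bot'.2 hD)).isInducing
  obtain ⟨κ, hκ, hbound⟩ := (hG.isTheta_sub hD').isBigO_symm.exists_pos
  exact ⟨κ, hκ, hbound.bound⟩

/-- Corollary 2.1(iii): local Lipschitzian error bound for the ℓ₁-regularized problem
under condition (a) or condition (b). -/
theorem local_error_bound_l1 {n : ℕ}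
    (lam : ℝ) (hlam : 0 < lam)
    (g : EuclideanSpace ℝ (Fin n) → ℝ) (hg : ∀ z, g z = lam * ∑ i, |z i|)
    (f : EuclideanSpace ℝ (Fin n) → ℝ)
    (f' : EuclideanSpace ℝ (Fin n) → EuclideanSpace ℝ (Fin n))
    (f'' : EuclideanSpace ℝ (Fin n) → EuclideanSpace ℝ (Fin n) →L[ℝ] EuclideanSpace ℝ (Fin n))
    (hf1 : ∀ z, HasGradientAt f (f' z) z)
    (hf2 : ∀ z, HasFDerivAt f' (f'' z) z)
    (hf2c : Continuous f'')
    (proxg : EuclideanSpace ℝ (Fin n) → EuclideanSpace ℝ (Fin n))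
    (hproxg : ∀ w z : EuclideanSpace ℝ (Fin n),
        1/2 * ‖proxg w - w‖ ^ 2 + g (proxg w) ≤ 1/2 * ‖z - w‖ ^ 2 + g z)
    (xb : EuclideanSpace ℝ (Fin n))
    (hxb : -f' xb ∈ RSubdiff g xb)
    (hcond :
      -- condition (a)
      ((∀ i : Fin n, xb i = 0 → |f' xb i| < lam) ∧
        ∀ u : EuclideanSpace ℝ (Fin n),
          ((u, -(f'' xb u)) : EuclideanSpace ℝ (Fin n) × EuclideanSpace ℝ (Fin n)) ∈
            TanCone {p : EuclideanSpace ℝ (Fin n) × EuclideanSpace ℝ (Fin n) |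
              p.2 ∈ RSubdiff g p.1} (xb, -f' xb) →
          ∀ i : Fin n, xb i ≠ 0 → u i = 0) ∨
      -- condition (b)
      (Function.Bijective (fun h : EuclideanSpace ℝ (Fin n) => f'' xb h - h) ∧
        (∀ u : EuclideanSpace ℝ (Fin n), (∀ i : Fin n, xb i = 0 → u i = 0) →
            (∀ i : Fin n, xb i ≠ 0 → (f'' xb u) i = 0) → u = 0) ∧
        ∀ i : Fin n, xb i = 0 → |f' xb i| < lam)) :
    ∃ κ : ℝ, 0 < κ ∧ ∃ δ : ℝ, 0 < δ ∧ ∀ z ∈ Metric.ball xb δ,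
      Metric.infDist z {w : EuclideanSpace ℝ (Fin n) | -f' w ∈ RSubdiff g w} ≤
        κ * ‖z - proxg (z - f' z)‖ := by
  have hstrict : ∀ i, xb i = 0 → |f' xb i| < lam := hcond.elim (·.1) (·.2.2)
  have hnonsing : ∀ u : EuclideanSpace ℝ (Fin n), (∀ i, xb i = 0 → u i = 0) →
      (∀ i, xb i ≠ 0 → (f'' xb u) i = 0) → u = 0 := by
    rcases hcond with ⟨-, htan⟩ | ⟨-, h, -⟩
    · intro u hu hHu
      have hmem := mem_TanCone_graph_RSubdiff_l1 hg (w := -(f'' xb u)) hxb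
        (by simpa using hstrict) hu (by simpa using hHu)
      ext i
      by_cases hi : xb i = 0
      · exact hu i hi
      · exact htan u hmem i hi
    · exact h
  have hderiv : HasFDerivAt (fun z => z - suppProj xb z + suppProj xb (f' z))
      (ContinuousLinearMap.id ℝ (EuclideanSpace ℝ (Fin n)) - suppProj xb +
        (suppProj xb).comp (f'' xb)) xb :=
    ((hasFDerivAt_id xb).sub (suppProj xb).hasFDerivAt).add
      ((suppProj xb).hasFDerivAt.comp xb (hf2 xb))
  obtain ⟨κ, hκ, hbound⟩ := hderiv.exists_norm_sub_le_of_injective fun u hu => by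
    have hui : ∀ i, u i - suppProj xb u i + suppProj xb (f'' xb u) i = 0 := fun i =>
      congrArg (fun w : EuclideanSpace ℝ (Fin n) => w i) hu
    refine hnonsing u (fun i hi => ?_) (fun i hi => ?_)
    · simpa [suppProj_apply, hi] using hui i
    · simpa [suppProj_apply, hi] using hui i
  obtain ⟨δ, hδ, hball⟩ := Metric.eventually_nhds_iff_ball.1 (hbound.and
    (eventually_sub_prox_l1_eq hg hproxg (hf2 xb).continuousAt hxb hstrict))
  refine ⟨κ, hκ, δ, hδ, fun z hz => ?_⟩
  obtain ⟨h1, h2⟩ := hball z hz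
  have hproj : suppProj xb xb = xb := by
    ext i
    by_cases hi : xb i = 0 <;> simp [suppProj_apply, hi]
  have h3 : z - suppProj xb z + suppProj xb (f' z) -
      (xb - suppProj xb xb + suppProj xb (f' xb)) = z - proxg (z - f' z) := by
    rw [h2, hproj, map_sub]
    abel
  rw [h3, ← dist_eq_norm] at h1
  have hmem : xb ∈ {w : EuclideanSpace ℝ (Fin n) | -f' w ∈ RSubdiff g w} := hxb
  exact (Metric.infDist_le_dist_of_mem hmem).trans h1
end

section
/- Fix x̂ ∈ dom g with r(x̂) ≠ 0 and q ∈ [2,3], and set ϑ(z) := f(x̂) + ⟨∇f(x̂), z − x̂⟩ + (1/2)⟨z − x̂, ∇²f(x̂)(z − x̂)⟩ and, for L > 0, Θ_L := ϑ + (L/q)‖· − x̂‖^q + g. Then there exists L̄ > 0 such that for every L ≥ L̄ the function Θ_L is coercive and attains a global minimizer ȳ; every such global minimizer ȳ is a stationary point of Θ_L (i.e., 0 ∈ ∇ϑ(ȳ) + L‖ȳ − x̂‖^{q−2}(ȳ − x̂) + ∂g(ȳ)) and satisfies Θ_L(ȳ) < Θ_L(x̂). -/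
open Filter Metric Real Set
open scoped InnerProductSpace Topology Pointwise

/-- The convex subdifferential of an extended-real-valued function `g` at `x`. -/
noncomputable def ESubdiff {X : Type*} [NormedAddCommGroup X] [InnerProductSpace ℝ X]
    (g : X → EReal) (x : X) : Set X :=
  {v | ∀ z : X, g x + ((⟪v, z - x⟫_ℝ : ℝ) : EReal) ≤ g z}

/-- First-order necessary condition for a minimizer of the sum of a differentiable function and
a convex extended-real-valued function. -/
theorem neg_mem_eSubdiff_of_minimizer
    {X : Type*} [NormedAddCommGroup X] [InnerProductSpace ℝ X] {g : X → EReal}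
    (hgnebot : ∀ z : X, g z ≠ ⊥)
    (hgconv : ∀ u w : X, ∀ t : ℝ, t ∈ Set.Ioo (0:ℝ) 1 →
        g (t • u + (1 - t) • w) ≤ (t : EReal) * g u + ((1 - t : ℝ) : EReal) * g w)
    {ψ : X → ℝ} {G y : X} (hψ : HasFDerivAt ψ (innerSL ℝ G) y) (hy : g y ≠ ⊤)
    (hmin : ∀ z : X, (ψ y : EReal) + g y ≤ (ψ z : EReal) + g z) :
    -G ∈ ESubdiff g y := by
  intro z
  by_cases hz : g z = ⊤
  · rw [hz]
    exact le_top
  obtain ⟨a, ha⟩ : ∃ a : ℝ, g y = (a : EReal) :=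
    ⟨(g y).toReal, (EReal.coe_toReal hy (hgnebot y)).symm⟩
  obtain ⟨b, hb⟩ : ∃ b : ℝ, g z = (b : EReal) :=
    ⟨(g z).toReal, (EReal.coe_toReal hz (hgnebot z)).symm⟩
  have hline : HasDerivAt (fun t : ℝ => ψ (y + t • (z - y))) ⟪G, z - y⟫_ℝ 0 := by
    have h1 : HasDerivAt (fun t : ℝ => y + t • (z - y)) (z - y) 0 := by
      simpa using ((hasDerivAt_id (0:ℝ)).smul_const (z - y)).const_add y
    have h2 : HasFDerivAt ψ (innerSL ℝ G) (y + (0:ℝ) • (z - y)) := by simpa using hψ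
    simpa [Function.comp_def] using h2.comp_hasDerivAt (0:ℝ) h1
  have hslope := hline.tendsto_slope_zero_right
  have hev : ∀ᶠ t : ℝ in 𝓝[>] 0,
      a - b ≤ t⁻¹ • (ψ (y + (0 + t) • (z - y)) - ψ (y + (0:ℝ) • (z - y))) := by
    filter_upwards [Ioo_mem_nhdsGT (zero_lt_one' ℝ)] with t ht
    have h1 := (hmin (t • z + (1 - t) • y)).trans
      (add_le_add (le_refl _) (hgconv z y t ht))
    have hpt : y + t • (z - y) = t • z + (1 - t) • y := by module
    rw [ha, hb] at h1
    norm_cast at h1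
    rw [zero_add, zero_smul, add_zero, hpt, smul_eq_mul, inv_mul_eq_div, le_div_iff₀ ht.1]
    linarith
  have hle := ge_of_tendsto hslope hev
  rw [ha, hb, inner_neg_left]
  norm_cast
  linarith

/-- The value of a proximal mapping lies in the effective domain of a proper function. -/
theorem prox_ne_top {X : Type*} [NormedAddCommGroup X] {g : X → EReal} {w p : X}
    (hgproper : ∃ z : X, g z ≠ ⊤)
    (hp : ∀ z : X, ((1/2 * ‖p - w‖ ^ 2 : ℝ) : EReal) + g p ≤
      ((1/2 * ‖z - w‖ ^ 2 : ℝ) : EReal) + g z) :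
    g p ≠ ⊤ := by
  obtain ⟨z, hz⟩ := hgproper
  intro htop
  have h := hp z
  rw [htop, EReal.add_top_of_ne_bot (EReal.coe_ne_bot _), top_le_iff] at h
  exact (EReal.add_lt_top (EReal.coe_ne_top _) hz).ne h

/-- A convex function with a proximal point admits an affine minorant. -/
theorem exists_affine_minorant_of_prox
    {X : Type*} [NormedAddCommGroup X] [InnerProductSpace ℝ X] {g : X → EReal} {p : X}
    (hgproper : ∃ z : X, g z ≠ ⊤) (hgnebot : ∀ z : X, g z ≠ ⊥)
    (hgconv : ∀ u w : X, ∀ t : ℝ, t ∈ Set.Ioo (0:ℝ) 1 →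
        g (t • u + (1 - t) • w) ≤ (t : EReal) * g u + ((1 - t : ℝ) : EReal) * g w)
    {w : X}
    (hp : ∀ z : X, ((1/2 * ‖p - w‖ ^ 2 : ℝ) : EReal) + g p ≤
      ((1/2 * ‖z - w‖ ^ 2 : ℝ) : EReal) + g z) :
    ∃ (c : ℝ) (v : X), ∀ z : X, ((c + ⟪v, z⟫_ℝ : ℝ) : EReal) ≤ g z := by
  have hptop := prox_ne_top hgproper hp
  have hd : HasFDerivAt (fun z : X => 1/2 * ‖z - w‖ ^ 2) (innerSL ℝ (p - w)) p := by
    have h := (((hasFDerivAt_id p).sub_const w).norm_sq).const_mul (1/2 : ℝ)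
    refine h.congr_fderiv ?_
    ext v
    simp
  have hsub := neg_mem_eSubdiff_of_minimizer hgnebot hgconv hd hptop hp
  obtain ⟨a, ha⟩ : ∃ a : ℝ, g p = (a : EReal) :=
    ⟨(g p).toReal, (EReal.coe_toReal hptop (hgnebot p)).symm⟩
  refine ⟨a - ⟪-(p - w), p⟫_ℝ, -(p - w), fun z => ?_⟩
  have h := hsub z
  rw [ha, inner_sub_right, ← EReal.coe_add] at h
  convert h using 2
  ring

/-- A proximal fixed point characterization: a point `x` with `-v ∈ ∂g(x)` is the only
proximal point of `x - v`. -/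
theorem eq_prox_of_neg_mem_eSubdiff
    {X : Type*} [NormedAddCommGroup X] [InnerProductSpace ℝ X] {g : X → EReal} {x v p : X}
    (hgnebot : ∀ z : X, g z ≠ ⊥) (hx : g x ≠ ⊤)
    (hp : ∀ z : X, ((1/2 * ‖p - (x - v)‖ ^ 2 : ℝ) : EReal) + g p ≤
      ((1/2 * ‖z - (x - v)‖ ^ 2 : ℝ) : EReal) + g z)
    (hv : -v ∈ ESubdiff g x) : x = p := by
  have hptop := prox_ne_top ⟨x, hx⟩ hp
  obtain ⟨a, ha⟩ : ∃ a : ℝ, g x = (a : EReal) :=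
    ⟨(g x).toReal, (EReal.coe_toReal hx (hgnebot x)).symm⟩
  obtain ⟨b, hb⟩ : ∃ b : ℝ, g p = (b : EReal) :=
    ⟨(g p).toReal, (EReal.coe_toReal hptop (hgnebot p)).symm⟩
  have h1 := hp x
  have h2 := hv p
  rw [ha, hb] at h1 h2
  norm_cast at h1 h2
  have e1 : p - (x - v) = (p - x) + v := by abel
  have e2 : x - (x - v) = v := by abel
  rw [e1, e2, norm_add_sq_real] at h1
  rw [inner_neg_left, real_inner_comm] at h2
  have h3 : ‖p - x‖ ^ 2 ≤ 0 := by linarith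
  have h4 : p - x = 0 := by
    rw [← norm_eq_zero]
    exact pow_eq_zero_iff two_ne_zero |>.1 (le_antisymm h3 (sq_nonneg _))
  exact (sub_eq_zero.1 h4).symm

/-- The derivative of the gradient of a twice differentiable function is symmetric. -/
theorem inner_fderiv_gradient_comm
    {X : Type*} [NormedAddCommGroup X] [InnerProductSpace ℝ X] [FiniteDimensional ℝ X]
    {f : X → ℝ} {f' : X → X} {H : X →L[ℝ] X} {x : X}
    (hf : ∀ᶠ z in 𝓝 x, HasGradientAt f (f' z) z) (hf' : HasFDerivAt f' H x) (u v : X) :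
    ⟪H u, v⟫_ℝ = ⟪H v, u⟫_ℝ := by
  let J : X →ₗ[ℝ] (X →L[ℝ] ℝ) :=
    { toFun := fun w => innerSL ℝ w
      map_add' := fun a b => by simp
      map_smul' := fun a b => by simp }
  have h := second_derivative_symmetric_of_eventually (𝕜 := ℝ) (f := f)
    (f' := fun z => J.toContinuousLinearMap (f' z))
    (f'' := J.toContinuousLinearMap.comp H) (x := x)
    (hf.mono fun z hz => hz.hasFDerivAt)
    ((J.toContinuousLinearMap.hasFDerivAt (x := f' x)).comp x hf') u v
  simpa [J] using h

/-- A lower semicontinuous function on a proper space which tends to `⊤` at infinity attains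
its infimum. -/
theorem LowerSemicontinuous.exists_forall_le_of_coercive
    {X : Type*} [NormedAddCommGroup X] [ProperSpace X] {φ : X → EReal}
    (hφ : LowerSemicontinuous φ)
    (hcoe : Tendsto φ (Filter.comap (fun z : X => ‖z‖) atTop) (𝓝 (⊤ : EReal)))
    {x : X} (hx : φ x ≠ ⊤) : ∃ y : X, ∀ z : X, φ y ≤ φ z := by
  have hev : ∀ᶠ z in Filter.comap (fun z : X => ‖z‖) atTop, φ x < φ z :=
    hcoe.eventually (lt_mem_nhds hx.lt_top)
  rw [eventually_comap] at hev
  obtain ⟨R, hR⟩ := eventually_atTop.1 hev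
  have hxmem : x ∈ closedBall (0 : X) (max R ‖x‖) := by simp
  obtain ⟨y, -, hy⟩ := LowerSemicontinuousOn.exists_isMinOn ⟨x, hxmem⟩
    (isCompact_closedBall (0 : X) (max R ‖x‖)) (hφ.lowerSemicontinuousOn _)
  refine ⟨y, fun z => ?_⟩
  by_cases hz : z ∈ closedBall (0 : X) (max R ‖x‖)
  · exact hy hz
  · rw [mem_closedBall_zero_iff, not_le, max_lt_iff] at hz
    exact (hy hxmem).trans (hR _ hz.1.le z rfl).le

/-- Lemma 3.1(i): for all sufficiently large regularization parameters, the q-order regularized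
subproblem is coercive, has a global minimizer, and every global minimizer is a stationary
point of the subproblem whose objective value is smaller than that at the current point. -/
theorem subproblem_solvable_for_large_L
    {X : Type*} [NormedAddCommGroup X] [InnerProductSpace ℝ X] [FiniteDimensional ℝ X]
    -- the data of problem (1): f twice continuously differentiable on an open set O ⊇ dom g,
    -- g proper lsc convex, F = f + g bounded below
    (f : X → ℝ) (g : X → EReal) (f' : X → X) (f'' : X → X →L[ℝ] X)
    (O : Set X) (hO : IsOpen O) (hOdom : {z : X | g z ≠ ⊤} ⊆ O)
    (hgproper : ∃ z : X, g z ≠ ⊤) (hgnebot : ∀ z : X, g z ≠ ⊥)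
    (hglsc : LowerSemicontinuous g)
    (hgconv : ∀ u w : X, ∀ t : ℝ, t ∈ Set.Ioo (0:ℝ) 1 →
        g (t • u + (1 - t) • w) ≤ (t : EReal) * g u + ((1 - t : ℝ) : EReal) * g w)
    (hf1 : ∀ z ∈ O, HasGradientAt f (f' z) z)
    (hf2 : ∀ z ∈ O, HasFDerivAt f' (f'' z) z)
    (hf2c : ContinuousOn f'' O)
    -- the proximal mapping of g
    (proxg : X → X)
    (hproxg : ∀ w z : X,
        ((1/2 * ‖proxg w - w‖ ^ 2 : ℝ) : EReal) + g (proxg w) ≤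
          ((1/2 * ‖z - w‖ ^ 2 : ℝ) : EReal) + g z)
    (F : X → EReal) (hF : ∀ z : X, F z = (f z : EReal) + g z)
    (hFbdd : ∃ m : ℝ, ∀ z : X, (m : EReal) ≤ F z)
    (xh : X) (hxh : g xh ≠ ⊤) (hrxh : ‖xh - proxg (xh - f' xh)‖ ≠ 0)
    (q : ℝ) (hq : q ∈ Set.Icc (2:ℝ) 3)
    (ϑ : X → ℝ)
    (hϑ : ∀ z : X, ϑ z = f xh + ⟪f' xh, z - xh⟫_ℝ + 1/2 * ⟪z - xh, f'' xh (z - xh)⟫_ℝ)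
    (Θ : ℝ → X → EReal)
    (hΘ : ∀ l : ℝ, ∀ z : X, Θ l z = ((ϑ z + l / q * ‖z - xh‖ ^ q : ℝ) : EReal) + g z) :
    ∃ Lbar : ℝ, 0 < Lbar ∧ ∀ l : ℝ, Lbar ≤ l →
      -- Θ_l is coercive
      (Tendsto (Θ l) (Filter.comap (fun z : X => ‖z‖) atTop) (𝓝 (⊤ : EReal))) ∧
      -- Θ_l attains a global minimizer
      (∃ yb : X, ∀ z : X, Θ l yb ≤ Θ l z) ∧
      -- every global minimizer is a stationary point of Θ_l with smaller value than at xh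
      (∀ yb : X, (∀ z : X, Θ l yb ≤ Θ l z) →
        (-(f' xh + f'' xh (yb - xh) + (l * ‖yb - xh‖ ^ (q - 2)) • (yb - xh)) ∈
            ESubdiff g yb) ∧
        Θ l yb < Θ l xh) := by
  have : ProperSpace X := FiniteDimensional.proper ℝ X
  obtain ⟨c, v, hcv⟩ := exists_affine_minorant_of_prox hgproper hgnebot hgconv (hproxg 0)
  have hq0 : 0 < q := by linarith [hq.1]
  have hxO : xh ∈ O := hOdom hxh
  have hsymm := inner_fderiv_gradient_comm
    (Filter.Eventually.mono (hO.mem_nhds hxO) hf1) (hf2 xh hxO)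
  refine ⟨3 * (‖f'' xh‖ + 1), by positivity, fun l hl => ?_⟩
  have hderiv : ∀ y : X, HasFDerivAt (fun z => ϑ z + l / q * ‖z - xh‖ ^ q)
      (innerSL ℝ (f' xh + f'' xh (y - xh) + (l * ‖y - xh‖ ^ (q - 2)) • (y - xh))) y := by
    intro y
    have hs : HasFDerivAt (fun z : X => z - xh) (ContinuousLinearMap.id ℝ X) y :=
      (hasFDerivAt_id y).sub_const xh
    have h1 : HasFDerivAt (fun z : X => ⟪f' xh, z - xh⟫_ℝ)
        ((innerSL ℝ (f' xh)).comp (ContinuousLinearMap.id ℝ X)) y :=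
      (innerSL ℝ (f' xh)).hasFDerivAt.comp y hs
    have h2 := hs.inner ℝ ((f'' xh).hasFDerivAt.comp y hs)
    have h3 := (hasFDerivAt_norm_rpow (y - xh) (p := q) (by linarith [hq.1])).comp y hs
    have h4 := ((h1.const_add (f xh)).add (h2.const_mul (1/2))).add (h3.const_mul (l / q))
    have h5 : (fun z => ϑ z + l / q * ‖z - xh‖ ^ q) = fun z =>
        f xh + ⟪f' xh, z - xh⟫_ℝ + 1/2 * ⟪z - xh, f'' xh (z - xh)⟫_ℝ
          + l / q * ‖z - xh‖ ^ q := by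
      funext z
      rw [hϑ]
    rw [h5]
    refine h4.congr_fderiv ?_
    ext w
    have hw : ⟪y - xh, f'' xh w⟫_ℝ = ⟪f'' xh (y - xh), w⟫_ℝ := by
      rw [real_inner_comm, hsymm]
    have hw' : ⟪w, f'' xh (y - xh)⟫_ℝ = ⟪f'' xh (y - xh), w⟫_ℝ := real_inner_comm _ _
    simp [fderivInnerCLM_apply, -map_sub, hw, hw']
    field_simp
    ring
  have hΘtop : Θ l xh ≠ ⊤ := by
    rw [hΘ]
    exact (EReal.add_lt_top (EReal.coe_ne_top _) hxh).ne
  have hlsc : LowerSemicontinuous (Θ l) := by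
    have hcont : Continuous fun z => ((ϑ z + l / q * ‖z - xh‖ ^ q : ℝ) : EReal) :=
      continuous_coe_real_ereal.comp
        (continuous_iff_continuousAt.2 fun y => (hderiv y).continuousAt)
    have h := hcont.lowerSemicontinuous.add' hglsc fun x =>
      EReal.continuousAt_add (Or.inl (EReal.coe_ne_top _)) (Or.inl (EReal.coe_ne_bot _))
    rwa [show Θ l = _ from funext (hΘ l)]
  have hcoer : Tendsto (Θ l) (Filter.comap (fun z : X => ‖z‖) atTop) (𝓝 (⊤ : EReal)) := by
    rw [EReal.tendsto_nhds_top_iff_real]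
    intro M
    rw [eventually_comap]
    set A : ℝ := ‖f' xh‖ + ‖v‖ with hA
    set C : ℝ := f xh + c + ⟪v, xh⟫_ℝ with hC
    have hlarge : ∀ᶠ r : ℝ in atTop, 1 + A + |M - C| + ‖xh‖ < r := eventually_gt_atTop _
    filter_upwards [hlarge] with r hr z hz
    have hs : 1 + A + |M - C| < ‖z - xh‖ := by
      have := norm_sub_norm_le z xh
      linarith
    have hA0 : 0 ≤ A := by positivity
    have hs1 : 1 ≤ ‖z - xh‖ := by linarith [abs_nonneg (M - C)]
    have hpow : ‖z - xh‖ ^ 2 ≤ ‖z - xh‖ ^ q := by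
      rw [← Real.rpow_two]
      exact Real.rpow_le_rpow_of_exponent_le hs1 hq.1
    have hlq : ‖f'' xh‖ + 1 ≤ l / q := by
      rw [le_div_iff₀ hq0]
      nlinarith [norm_nonneg (f'' xh), hq.2]
    have hlq0 : 0 ≤ l / q := le_trans (by positivity) hlq
    have hreg : (‖f'' xh‖ + 1) * ‖z - xh‖ ^ 2 ≤ l / q * ‖z - xh‖ ^ q := by gcongr
    have hin1 := neg_le_of_abs_le (abs_real_inner_le_norm (f' xh) (z - xh))
    have hin2 := neg_le_of_abs_le (abs_real_inner_le_norm v (z - xh))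
    have hin3 := neg_le_of_abs_le (abs_real_inner_le_norm (z - xh) (f'' xh (z - xh)))
    have hop : ‖z - xh‖ * ‖f'' xh (z - xh)‖ ≤ ‖f'' xh‖ * ‖z - xh‖ ^ 2 := by
      nlinarith [(f'' xh).le_opNorm (z - xh), norm_nonneg (z - xh)]
    have hvz : ⟪v, z⟫_ℝ = ⟪v, z - xh⟫_ℝ + ⟪v, xh⟫_ℝ := by
      rw [← inner_add_right, sub_add_cancel]
    have hHnonneg : 0 ≤ ‖f'' xh‖ * ‖z - xh‖ ^ 2 := by positivity
    have hmain : M < ϑ z + l / q * ‖z - xh‖ ^ q + (c + ⟪v, z⟫_ℝ) := by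
      rw [hϑ, hvz]
      have hquad : (1 + |M - C|) * 1 ≤ (‖z - xh‖ - A) * ‖z - xh‖ := by
        have : 0 ≤ |M - C| := abs_nonneg _
        gcongr
        · linarith
        · linarith
      have := le_abs_self (M - C)
      rw [hA] at hquad
      rw [hC] at this hquad
      nlinarith
    rw [hΘ]
    refine lt_of_lt_of_le ?_ (add_le_add (le_refl _) (hcv z))
    exact_mod_cast hmain
  refine ⟨hcoer, hlsc.exists_forall_le_of_coercive hcoer hΘtop, ?_⟩
  have hstat : ∀ yb : X, (∀ z : X, Θ l yb ≤ Θ l z) →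
      -(f' xh + f'' xh (yb - xh) + (l * ‖yb - xh‖ ^ (q - 2)) • (yb - xh)) ∈ ESubdiff g yb := by
    intro yb hyb
    refine neg_mem_eSubdiff_of_minimizer hgnebot hgconv (hderiv yb) ?_ fun z => ?_
    · intro htop
      have h := hyb xh
      rw [hΘ l yb, htop, EReal.add_top_of_ne_bot (EReal.coe_ne_bot _), top_le_iff] at h
      exact hΘtop h
    · simpa only [hΘ] using hyb z
  intro yb hyb
  refine ⟨hstat yb hyb, (hyb xh).lt_of_ne fun heq => hrxh ?_⟩
  have hx := hstat xh fun z => heq ▸ hyb z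
  rw [sub_self, map_zero, smul_zero, add_zero, add_zero] at hx
  rw [← eq_prox_of_neg_mem_eSubdiff hgnebot hxh (hproxg _) hx, sub_self, norm_zero]
end

section
/- Fix x̂ ∈ dom g with r(x̂) ≠ 0, q ∈ [2,3], ϱ ∈ (0,1) and L > 0, and set ϑ(z) := f(x̂) + ⟨∇f(x̂), z − x̂⟩ + (1/2)⟨z − x̂, ∇²f(x̂)(z − x̂)⟩, Θ_L := ϑ + (L/q)‖· − x̂‖^q + g, R_L(y) := y − prox_g(y − ∇ϑ(y) − L‖y − x̂‖^{q−2}(y − x̂)) and r_L(y) := ‖R_L(y)‖. Let ȳ be a stationary point of Θ_L (i.e., R_L(ȳ) = 0) with Θ_L(ȳ) < Θ_L(x̂). Then there exists δ > 0 such that for every y ∈ dom g ∩ B(ȳ, δ), the point ŷ := y − R_L(y) satisfies the inexactness criterion r_L(ŷ) ≤ ϱ L ‖ŷ − x̂‖^{q−1} and Θ_L(ŷ) < Θ_L(x̂). -/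
open Filter Metric Real Set
open scoped InnerProductSpace Topology Pointwise

/-- A minimizer map of `z ↦ ½‖z - w‖² + g z` takes values in the domain of `g`. -/
theorem prox_mem_domain {X : Type*} [NormedAddCommGroup X]
    {g : X → EReal} {p : X → X} (hgproper : ∃ z : X, g z ≠ ⊤)
    (hp : ∀ w z : X, ((1/2 * ‖p w - w‖ ^ 2 : ℝ) : EReal) + g (p w) ≤
      ((1/2 * ‖z - w‖ ^ 2 : ℝ) : EReal) + g z) (w : X) : g (p w) ≠ ⊤ := by
  obtain ⟨z, hz⟩ := hgproper
  intro h
  have h1 := hp w z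
  rw [h, EReal.coe_add_top, top_le_iff] at h1
  exact (EReal.add_lt_top (EReal.coe_ne_top _) hz).ne h1

/-- The proximal map of a midpoint-convex function is Lipschitz with constant `2`. -/
theorem norm_prox_sub_prox_le {X : Type*} [NormedAddCommGroup X] [InnerProductSpace ℝ X]
    {g : X → EReal} {p : X → X} (hgnebot : ∀ z : X, g z ≠ ⊥)
    (hgmid : ∀ u w : X, g ((1/2 : ℝ) • u + (1 - 1/2 : ℝ) • w) ≤
      ((1/2 : ℝ) : EReal) * g u + ((1 - 1/2 : ℝ) : EReal) * g w)
    (hdom : ∀ w, g (p w) ≠ ⊤)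
    (hp : ∀ w z : X, ((1/2 * ‖p w - w‖ ^ 2 : ℝ) : EReal) + g (p w) ≤
      ((1/2 * ‖z - w‖ ^ 2 : ℝ) : EReal) + g z) (w w' : X) :
    ‖p w' - p w‖ ≤ 2 * ‖w' - w‖ := by
  have h1 := hp w ((1/2 : ℝ) • p w + (1 - 1/2 : ℝ) • p w')
  have h2 := hp w' ((1/2 : ℝ) • p w + (1 - 1/2 : ℝ) • p w')
  have h3 := hgmid (p w) (p w')
  have hm : g ((1/2 : ℝ) • p w + (1 - 1/2 : ℝ) • p w') ≠ ⊤ := by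
    intro h
    rw [h, ← EReal.coe_toReal (hdom w) (hgnebot _), ← EReal.coe_toReal (hdom w') (hgnebot _)] at h3
    norm_cast at h3
  rw [← EReal.coe_toReal (hdom w) (hgnebot _), ← EReal.coe_toReal hm (hgnebot _)] at h1
  rw [← EReal.coe_toReal (hdom w') (hgnebot _), ← EReal.coe_toReal hm (hgnebot _)] at h2
  rw [← EReal.coe_toReal (hdom w) (hgnebot _), ← EReal.coe_toReal (hdom w') (hgnebot _),
    ← EReal.coe_toReal hm (hgnebot _)] at h3
  rw [← EReal.coe_add, ← EReal.coe_add, EReal.coe_le_coe_iff] at h1 h2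
  rw [← EReal.coe_mul, ← EReal.coe_mul, ← EReal.coe_add, EReal.coe_le_coe_iff] at h3
  have e1 : (1/2 : ℝ) • p w + (1 - 1/2 : ℝ) • p w' - w
      = (p w - w) + (1/2 : ℝ) • (p w' - p w) := by module
  have e2 : (1/2 : ℝ) • p w + (1 - 1/2 : ℝ) • p w' - w'
      = (p w' - w') - (1/2 : ℝ) • (p w' - p w) := by module
  rw [e1, norm_add_sq_real, norm_smul, inner_smul_right] at h1
  rw [e2, norm_sub_sq_real (p w' - w'), norm_smul, inner_smul_right] at h2
  have e3 : ⟪p w - w, p w' - p w⟫_ℝ - ⟪p w' - w', p w' - p w⟫_ℝ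
      = ⟪w' - w, p w' - p w⟫_ℝ - ‖p w' - p w‖ ^ 2 := by
    rw [← real_inner_self_eq_norm_sq, ← inner_sub_left, ← inner_sub_left]
    congr 1
    abel
  have e4 := real_inner_le_norm (w' - w) (p w' - p w)
  have e5 : ‖(1/2 : ℝ)‖ = 1/2 := by norm_num
  rw [e5] at h1 h2
  by_contra! hlt
  nlinarith [norm_nonneg (w' - w), norm_nonneg (p w' - p w)]

/-- Lemma 3.1(ii): near a stationary point ȳ of the regularized subproblem with
Θ_L(ȳ) < Θ_L(x̂), every point of the form y - R_L(y) with y ∈ dom g close to ȳ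
satisfies the inexactness criterion. -/
theorem inexact_criterion_near_stationary_point
    {X : Type*} [NormedAddCommGroup X] [InnerProductSpace ℝ X] [FiniteDimensional ℝ X]
    -- the data of problem (1): f twice continuously differentiable on an open set O ⊇ dom g,
    -- g proper lsc convex, F = f + g bounded below
    (f : X → ℝ) (g : X → EReal) (f' : X → X) (f'' : X → X →L[ℝ] X)
    (O : Set X) (hO : IsOpen O) (hOdom : {z : X | g z ≠ ⊤} ⊆ O)
    (hgproper : ∃ z : X, g z ≠ ⊤) (hgnebot : ∀ z : X, g z ≠ ⊥)
    (hglsc : LowerSemicontinuous g)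
    (hgconv : ∀ u w : X, ∀ t : ℝ, t ∈ Set.Ioo (0:ℝ) 1 →
        g (t • u + (1 - t) • w) ≤ (t : EReal) * g u + ((1 - t : ℝ) : EReal) * g w)
    (hf1 : ∀ z ∈ O, HasGradientAt f (f' z) z)
    (hf2 : ∀ z ∈ O, HasFDerivAt f' (f'' z) z)
    (hf2c : ContinuousOn f'' O)
    -- the proximal mapping of g
    (proxg : X → X)
    (hproxg : ∀ w z : X,
        ((1/2 * ‖proxg w - w‖ ^ 2 : ℝ) : EReal) + g (proxg w) ≤
          ((1/2 * ‖z - w‖ ^ 2 : ℝ) : EReal) + g z)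
    (F : X → EReal) (hF : ∀ z : X, F z = (f z : EReal) + g z)
    (hFbdd : ∃ m : ℝ, ∀ z : X, (m : EReal) ≤ F z)
    (xh : X) (hxh : g xh ≠ ⊤) (hrxh : ‖xh - proxg (xh - f' xh)‖ ≠ 0)
    (q ϱ l : ℝ) (hq : q ∈ Set.Icc (2:ℝ) 3) (hϱ : ϱ ∈ Set.Ioo (0:ℝ) 1) (hl : 0 < l)
    (ϑ : X → ℝ)
    (hϑ : ∀ z : X, ϑ z = f xh + ⟪f' xh, z - xh⟫_ℝ + 1/2 * ⟪z - xh, f'' xh (z - xh)⟫_ℝ)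
    (Θ : X → EReal)
    (hΘ : ∀ z : X, Θ z = ((ϑ z + l / q * ‖z - xh‖ ^ q : ℝ) : EReal) + g z)
    (RL : X → X)
    (hRL : ∀ z : X, RL z = z - proxg (z -
        (f' xh + f'' xh (z - xh) + (l * ‖z - xh‖ ^ (q - 2)) • (z - xh))))
    (yb : X) (hyb1 : RL yb = 0) (hyb2 : Θ yb < Θ xh) :
    ∃ δ : ℝ, 0 < δ ∧ ∀ y0 : X, g y0 ≠ ⊤ → y0 ∈ Metric.ball yb δ →
      ‖RL (y0 - RL y0)‖ ≤ ϱ * l * ‖(y0 - RL y0) - xh‖ ^ (q - 1) ∧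
      Θ (y0 - RL y0) < Θ xh := by
  obtain ⟨hq2, -⟩ := hq
  have hdom := prox_mem_domain hgproper hproxg
  have hlip := norm_prox_sub_prox_le hgnebot
    (fun u w => hgconv u w (1/2) ⟨by norm_num, by norm_num⟩) hdom hproxg
  have hpc : Continuous proxg := by
    refine (LipschitzWith.of_dist_le_mul (K := 2) fun w' w => ?_).continuous
    simpa [dist_eq_norm] using hlip w w'
  have hpow : Continuous fun z : X => ‖z - xh‖ ^ (q - 2) :=
    (by fun_prop : Continuous fun z : X => ‖z - xh‖).rpow_const fun _ => Or.inr (by linarith)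
  have hpow1 : Continuous fun z : X => ‖z - xh‖ ^ (q - 1) :=
    (by fun_prop : Continuous fun z : X => ‖z - xh‖).rpow_const fun _ => Or.inr (by linarith)
  have hpowq : Continuous fun z : X => ‖z - xh‖ ^ q :=
    (by fun_prop : Continuous fun z : X => ‖z - xh‖).rpow_const fun _ => Or.inr (by linarith)
  obtain ⟨W, hW⟩ : ∃ W : X → X, ∀ z, W z = z -
    (f' xh + f'' xh (z - xh) + (l * ‖z - xh‖ ^ (q - 2)) • (z - xh)) := ⟨_, fun _ => rfl⟩
  have hWc : Continuous W := by
    rw [funext hW]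
    fun_prop
  have hT : ∀ z, z - RL z = proxg (W z) := fun z => by rw [hRL, hW, sub_sub_cancel]
  have hRLc : Continuous RL := by
    have : RL = fun z => z - proxg (W z) := funext fun z => by rw [hRL, hW]
    rw [this]
    fun_prop
  have hTb : proxg (W yb) = yb := by rw [← hT, hyb1, sub_zero]
  obtain ⟨H, hH⟩ : ∃ H : X → ℝ, ∀ z, H z = ϑ z + l / q * ‖z - xh‖ ^ q := ⟨_, fun _ => rfl⟩
  have hHc : Continuous H := by
    rw [funext hH, funext hϑ]
    fun_prop
  have hΘr : ∀ z, g z ≠ ⊤ → Θ z = ((H z + (g z).toReal : ℝ) : EReal) := fun z hz => by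
    rw [hΘ, hH, EReal.coe_add _ (g z).toReal, EReal.coe_toReal hz (hgnebot z)]
  have hgyb : g yb ≠ ⊤ := hTb ▸ hdom (W yb)
  have hne : yb ≠ xh := by
    rintro rfl
    exact lt_irrefl _ hyb2
  have hpos : 0 < ‖yb - xh‖ := norm_pos_iff.mpr (sub_ne_zero.mpr hne)
  rw [hΘr yb hgyb, hΘr xh hxh, EReal.coe_lt_coe_iff] at hyb2
  have hcrit : ∀ᶠ y in 𝓝 yb,
      ‖RL (proxg (W y))‖ < ϱ * l * ‖proxg (W y) - xh‖ ^ (q - 1) := by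
    have hc : Continuous fun y => ‖proxg (W y) - xh‖ ^ (q - 1) :=
      hpow1.comp (hpc.comp hWc)
    refine ContinuousAt.eventually_lt (by fun_prop) (hc.const_mul _).continuousAt ?_
    rw [hTb, hyb1, norm_zero]
    have := hϱ.1
    positivity
  have hdesc : ∀ᶠ y in 𝓝 yb, H (proxg (W y)) + ((g yb).toReal + 1/2 * ‖yb - W y‖ ^ 2
      - 1/2 * ‖proxg (W y) - W y‖ ^ 2) < H xh + (g xh).toReal := by
    refine ContinuousAt.eventually_lt (by fun_prop) (by fun_prop) ?_
    rw [hTb]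
    linarith
  obtain ⟨δ, hδ, hball⟩ := Metric.eventually_nhds_iff_ball.mp (hcrit.and hdesc)
  refine ⟨δ, hδ, fun y _ hy => ?_⟩
  obtain ⟨h1, h2⟩ := hball y hy
  rw [hT]
  refine ⟨h1.le, ?_⟩
  rw [hΘr _ (hdom _), hΘr xh hxh, EReal.coe_lt_coe_iff]
  have h3 := hproxg (W y) yb
  rw [← EReal.coe_toReal (hdom (W y)) (hgnebot _), ← EReal.coe_toReal hgyb (hgnebot _),
    ← EReal.coe_add, ← EReal.coe_add, EReal.coe_le_coe_iff] at h3
  linarith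
end

section
/- Fix x̂ ∈ dom g with r(x̂) ≠ 0, q ∈ [2,3], σ ∈ (0,1), ϱ ∈ (0,1), τ > 1 and L₀ > 0. For j ∈ ℕ let L_j := τ^j L₀, and with ϑ(z) := f(x̂) + ⟨∇f(x̂), z − x̂⟩ + (1/2)⟨z − x̂, ∇²f(x̂)(z − x̂)⟩ define Θ_{L_j} := ϑ + (L_j/q)‖· − x̂‖^q + g, R_{L_j}(y) := y − prox_g(y − ∇ϑ(y) − L_j‖y − x̂‖^{q−2}(y − x̂)) and r_{L_j} := ‖R_{L_j}‖. Suppose for every j ∈ ℕ the point y^j ∈ dom g satisfies r_{L_j}(y^j) ≤ ϱ L_j ‖y^j − x̂‖^{q−1} and Θ_{L_j}(y^j) < Θ_{L_j}(x̂). Then there exists j ∈ ℕ with F(y^j) ≤ F(x̂) − σ (L_j/q) ‖y^j − x̂‖^q; in other words, the backtracking inner loop of the algorithm terminates in finitely many steps. -/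
open Filter Metric Real Set
open scoped InnerProductSpace Topology Pointwise

/-- A nonnegative affine function of a small positive parameter has nonnegative constant term. -/
lemma nonneg_of_forall_add_mul_nonneg {a b : ℝ}
    (h : ∀ t ∈ Set.Ioo (0 : ℝ) 1, 0 ≤ a + t * b) : 0 ≤ a := by
  have hlim : Tendsto (fun t : ℝ => a + t * b) (𝓝[>] 0) (𝓝 a) := by
    have hc : ContinuousAt (fun t : ℝ => a + t * b) 0 := by fun_prop
    have := hc.tendsto.mono_left (nhdsWithin_le_nhds (s := Set.Ioi (0 : ℝ)))
    simpa using this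
  refine ge_of_tendsto hlim ?_
  filter_upwards [Ioo_mem_nhdsGT (zero_lt_one' ℝ)] with t ht using h t ht

/-- A proximal point of a proper function lies in the domain of the function. -/
lemma prox_mem_dom {X : Type*} [NormedAddCommGroup X] {g : X → EReal} {w p x : X} (hx : g x ≠ ⊤)
    (hp : ∀ z : X, ((1/2 * ‖p - w‖ ^ 2 : ℝ) : EReal) + g p ≤
      ((1/2 * ‖z - w‖ ^ 2 : ℝ) : EReal) + g z) : g p ≠ ⊤ := by
  intro htop
  have h := hp x
  rw [htop, EReal.coe_add_top, top_le_iff] at h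
  exact (EReal.add_lt_top (EReal.coe_ne_top _) hx).ne h

section InnerProduct

variable {X : Type*} [NormedAddCommGroup X] [InnerProductSpace ℝ X]

/-- The variational inequality characterizing a proximal point of a convex function. -/
lemma prox_variational_inequality {g : X → EReal} (hgnebot : ∀ z : X, g z ≠ ⊥)
    (hgconv : ∀ u w : X, ∀ t : ℝ, t ∈ Set.Ioo (0:ℝ) 1 →
        g (t • u + (1 - t) • w) ≤ (t : EReal) * g u + ((1 - t : ℝ) : EReal) * g w)
    {w p : X}
    (hp : ∀ z : X, ((1/2 * ‖p - w‖ ^ 2 : ℝ) : EReal) + g p ≤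
      ((1/2 * ‖z - w‖ ^ 2 : ℝ) : EReal) + g z)
    {z : X} (hz : g z ≠ ⊤) :
    ⟪w - p, z - p⟫_ℝ ≤ (g z).toReal - (g p).toReal := by
  have hpt := prox_mem_dom hz hp
  suffices h : 0 ≤ ((g z).toReal - (g p).toReal) - ⟪w - p, z - p⟫_ℝ by linarith
  refine nonneg_of_forall_add_mul_nonneg (b := 1 / 2 * ‖z - p‖ ^ 2) fun t ht => ?_
  have h1 := (hp (t • z + (1 - t) • p)).trans (add_le_add_right (hgconv z p t ht) _)
  rw [← EReal.coe_toReal hz (hgnebot z), ← EReal.coe_toReal hpt (hgnebot p)] at h1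
  norm_cast at h1
  have hu : t • z + (1 - t) • p - w = t • (z - p) - (w - p) := by module
  have hn := norm_sub_sq_real (t • (z - p)) (w - p)
  rw [hu, hn, norm_smul, real_inner_smul_left, real_inner_comm, norm_sub_rev p w, mul_pow,
    Real.norm_eq_abs, sq_abs] at h1
  have h2 : 0 ≤ t * (((g z).toReal - (g p).toReal) - ⟪w - p, z - p⟫_ℝ
      + t * (1 / 2 * ‖z - p‖ ^ 2)) := by
    linarith
  exact nonneg_of_mul_nonneg_right h2 ht.1

/-- The proximal mapping of a proper convex function is nonexpansive. -/
lemma prox_lipschitzWith_one {g : X → EReal} (hgnebot : ∀ z : X, g z ≠ ⊥)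
    (hgconv : ∀ u w : X, ∀ t : ℝ, t ∈ Set.Ioo (0:ℝ) 1 →
        g (t • u + (1 - t) • w) ≤ (t : EReal) * g u + ((1 - t : ℝ) : EReal) * g w)
    {proxg : X → X}
    (hproxg : ∀ w z : X,
        ((1/2 * ‖proxg w - w‖ ^ 2 : ℝ) : EReal) + g (proxg w) ≤
          ((1/2 * ‖z - w‖ ^ 2 : ℝ) : EReal) + g z)
    {x : X} (hx : g x ≠ ⊤) : LipschitzWith 1 proxg := by
  refine LipschitzWith.of_dist_le_mul fun v w => ?_
  rw [NNReal.coe_one, one_mul, dist_eq_norm, dist_eq_norm]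
  have h1 := prox_variational_inequality hgnebot hgconv (hproxg v)
    (prox_mem_dom hx (hproxg w))
  have h2 := prox_variational_inequality hgnebot hgconv (hproxg w)
    (prox_mem_dom hx (hproxg v))
  have h3 : ⟪v - proxg v, proxg w - proxg v⟫_ℝ + ⟪w - proxg w, proxg v - proxg w⟫_ℝ
      = ‖proxg v - proxg w‖ ^ 2 - ⟪v - w, proxg v - proxg w⟫_ℝ := by
    rw [← real_inner_self_eq_norm_sq, ← neg_sub (proxg v) (proxg w), inner_neg_right,
      neg_add_eq_sub, ← inner_sub_left, ← inner_sub_left]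
    congr 1
    abel
  have h4 := real_inner_le_norm (v - w) (proxg v - proxg w)
  by_contra! hlt
  have hpos : 0 < ‖proxg v - proxg w‖ := (norm_nonneg _).trans_lt hlt
  nlinarith

/-- Second-order Taylor expansion with Peano remainder for a function whose gradient is
differentiable at the base point. -/
lemma taylor_second_order_isLittleO [CompleteSpace X] {f : X → ℝ} {f' : X → X} {A : X →L[ℝ] X}
    {x : X} (hf : ∀ᶠ z in 𝓝 x, HasGradientAt f (f' z) z) (hf' : HasFDerivAt f' A x) :
    (fun z => f z - (f x + ⟪f' x, z - x⟫_ℝ + 1/2 * ⟪z - x, A (z - x)⟫_ℝ))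
      =o[𝓝 x] fun z => ‖z - x‖ ^ 2 := by
  refine Asymptotics.isLittleO_iff.2 fun ε hε => ?_
  obtain ⟨δ, hδ, hball⟩ :=
    Metric.eventually_nhds_iff_ball.1 (hf.and (hf'.isLittleO.def hε))
  filter_upwards [Metric.ball_mem_nhds x hδ] with z hz
  set v := z - x with hv
  have hmem : ∀ t ∈ Set.Icc (0 : ℝ) 1, x + t • v ∈ Metric.ball x δ := by
    intro t ht
    rw [mem_ball_iff_norm] at hz ⊢
    rw [add_sub_cancel_left, norm_smul, Real.norm_of_nonneg ht.1]
    exact (mul_le_of_le_one_left (norm_nonneg _) ht.2).trans_lt hz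
  let φ : ℝ → ℝ := fun t => f (x + t • v) - (t * ⟪f' x, v⟫_ℝ + t ^ 2 * (1/2 * ⟪v, A v⟫_ℝ))
  have hφ : ∀ t ∈ Set.Icc (0 : ℝ) 1,
      HasDerivWithinAt φ ⟪f' (x + t • v) - f' x - A (t • v), v⟫_ℝ (Set.Icc 0 1) t := by
    intro t ht
    have hline : HasDerivAt (fun s : ℝ => x + s • v) v t := by
      simpa using ((hasDerivAt_id t).smul_const v).const_add x
    have h1 := (hball _ (hmem t ht)).1.hasFDerivAt.comp_hasDerivAt t hline
    have h2 := ((hasDerivAt_id t).mul_const ⟪f' x, v⟫_ℝ).add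
      (((hasDerivAt_id t).pow 2).mul_const (1/2 * ⟪v, A v⟫_ℝ))
    have h3 := h1.sub h2
    refine (h3.congr_deriv ?_).hasDerivWithinAt
    simp only [InnerProductSpace.toDual_apply_apply, inner_sub_left, map_smul,
      real_inner_smul_left, real_inner_comm v (A v), id]
    norm_num
    ring
  have hbound : ∀ t ∈ Set.Icc (0 : ℝ) 1,
      ‖⟪f' (x + t • v) - f' x - A (t • v), v⟫_ℝ‖ ≤ ε * ‖v‖ ^ 2 := by
    intro t ht
    have h1 := (hball _ (hmem t ht)).2
    rw [add_sub_cancel_left, norm_smul, Real.norm_of_nonneg ht.1] at h1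
    have h2 : ε * (t * ‖v‖) ≤ ε * ‖v‖ :=
      mul_le_mul_of_nonneg_left (mul_le_of_le_one_left (norm_nonneg _) ht.2) hε.le
    calc _ ≤ ‖f' (x + t • v) - f' x - A (t • v)‖ * ‖v‖ := norm_inner_le_norm _ _
      _ ≤ (ε * ‖v‖) * ‖v‖ := mul_le_mul_of_nonneg_right (h1.trans h2) (norm_nonneg _)
      _ = ε * ‖v‖ ^ 2 := by ring
  have hmvt := (convex_Icc (0 : ℝ) 1).norm_image_sub_le_of_norm_hasDerivWithin_le hφ hbound
    (Set.left_mem_Icc.2 zero_le_one) (Set.right_mem_Icc.2 zero_le_one)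
  have hxv : x + v = z := by rw [hv]; abel
  simp only [φ, one_smul, zero_smul, add_zero, hxv, sub_zero, norm_one, mul_one] at hmvt
  rw [norm_pow, norm_norm]
  refine le_trans (le_of_eq ?_) hmvt
  congr 1
  ring

end InnerProduct

/-- If `L j → ∞` and `L j * d j ^ q` is bounded by a fixed quadratic in `d j`, then `d j → 0`. -/
lemma tendsto_zero_of_mul_rpow_le_quadratic {L d : ℕ → ℝ} {q a b c : ℝ} (hq : 2 ≤ q)
    (ha : 0 ≤ a) (hb : 0 ≤ b) (hc : 0 ≤ c) (hL : Tendsto L atTop atTop) (hd : ∀ j, 0 ≤ d j)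
    (h : ∀ j, L j * d j ^ q ≤ a + b * d j + c * d j ^ 2) : Tendsto d atTop (𝓝 0) := by
  refine Metric.tendsto_nhds.2 fun ε hε => ?_
  have hεq : 0 < ε ^ q := Real.rpow_pos_of_pos hε q
  filter_upwards [hL.eventually_gt_atTop ((a + b * ε + c * ε ^ 2) / ε ^ q)] with j hj
  rw [Real.dist_0_eq_abs, abs_of_nonneg (hd j)]
  by_contra! hle
  rw [div_lt_iff₀ hεq] at hj
  obtain ⟨s, hs⟩ : ∃ s, d j = ε * s := ⟨d j / ε, by field_simp⟩
  have hs1 : 1 ≤ s := by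
    rw [hs] at hle
    exact le_of_mul_le_mul_left (by simpa using hle) hε
  have hs2 : s ^ 2 ≤ s ^ q := by
    rw [← Real.rpow_natCast]
    exact Real.rpow_le_rpow_of_exponent_le hs1 (by exact_mod_cast hq)
  have hss : s ≤ s ^ 2 := le_self_pow₀ hs1 two_ne_zero
  have hspos : 0 < s ^ q := by linarith
  have hj' := h j
  rw [hs, Real.mul_rpow hε.le (by linarith)] at hj'
  have h1 : a * 1 ≤ a * s ^ q := mul_le_mul_of_nonneg_left (by linarith) ha
  have h2 : b * ε * s ≤ b * ε * s ^ q :=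
    mul_le_mul_of_nonneg_left (by linarith) (by positivity)
  have h3 : c * ε ^ 2 * s ^ 2 ≤ c * ε ^ 2 * s ^ q :=
    mul_le_mul_of_nonneg_left (by linarith) (by positivity)
  have h4 := mul_lt_mul_of_pos_right hj hspos
  linarith

/-- Lemma 3.1(iii): the backtracking inner loop terminates in finitely many steps:
if for every j the point y^j satisfies the inexactness criterion for L_j = τ^j L₀,
then some j satisfies the descent condition. -/
theorem inner_loop_finite_termination
    {X : Type*} [NormedAddCommGroup X] [InnerProductSpace ℝ X] [FiniteDimensional ℝ X]
    -- the data of problem (1): f twice continuously differentiable on an open set O ⊇ dom g,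
    -- g proper lsc convex, F = f + g bounded below
    (f : X → ℝ) (g : X → EReal) (f' : X → X) (f'' : X → X →L[ℝ] X)
    (O : Set X) (hO : IsOpen O) (hOdom : {z : X | g z ≠ ⊤} ⊆ O)
    (hgproper : ∃ z : X, g z ≠ ⊤) (hgnebot : ∀ z : X, g z ≠ ⊥)
    (hglsc : LowerSemicontinuous g)
    (hgconv : ∀ u w : X, ∀ t : ℝ, t ∈ Set.Ioo (0:ℝ) 1 →
        g (t • u + (1 - t) • w) ≤ (t : EReal) * g u + ((1 - t : ℝ) : EReal) * g w)
    (hf1 : ∀ z ∈ O, HasGradientAt f (f' z) z)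
    (hf2 : ∀ z ∈ O, HasFDerivAt f' (f'' z) z)
    (hf2c : ContinuousOn f'' O)
    -- the proximal mapping of g
    (proxg : X → X)
    (hproxg : ∀ w z : X,
        ((1/2 * ‖proxg w - w‖ ^ 2 : ℝ) : EReal) + g (proxg w) ≤
          ((1/2 * ‖z - w‖ ^ 2 : ℝ) : EReal) + g z)
    (F : X → EReal) (hF : ∀ z : X, F z = (f z : EReal) + g z)
    (hFbdd : ∃ m : ℝ, ∀ z : X, (m : EReal) ≤ F z)
    (xh : X) (hxh : g xh ≠ ⊤) (hrxh : ‖xh - proxg (xh - f' xh)‖ ≠ 0)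
    (q σ ϱ τ L0 : ℝ) (hq : q ∈ Set.Icc (2:ℝ) 3)
    (hσ : σ ∈ Set.Ioo (0:ℝ) 1) (hϱ : ϱ ∈ Set.Ioo (0:ℝ) 1) (hτ : 1 < τ) (hL0 : 0 < L0)
    (Lj : ℕ → ℝ) (hLj : ∀ jj : ℕ, Lj jj = τ ^ jj * L0)
    (ϑ : X → ℝ)
    (hϑ : ∀ z : X, ϑ z = f xh + ⟪f' xh, z - xh⟫_ℝ + 1/2 * ⟪z - xh, f'' xh (z - xh)⟫_ℝ)
    (Θ : ℕ → X → EReal)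
    (hΘ : ∀ jj : ℕ, ∀ z : X, Θ jj z = ((ϑ z + Lj jj / q * ‖z - xh‖ ^ q : ℝ) : EReal) + g z)
    (RL : ℕ → X → X)
    (hRL : ∀ jj : ℕ, ∀ z : X, RL jj z = z - proxg (z -
        (f' xh + f'' xh (z - xh) + (Lj jj * ‖z - xh‖ ^ (q - 2)) • (z - xh))))
    (y : ℕ → X) (hydom : ∀ jj : ℕ, g (y jj) ≠ ⊤)
    (hinex1 : ∀ jj : ℕ, ‖RL jj (y jj)‖ ≤ ϱ * Lj jj * ‖y jj - xh‖ ^ (q - 1))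
    (hinex2 : ∀ jj : ℕ, Θ jj (y jj) < Θ jj xh) :
    ∃ jj : ℕ, F (y jj) ≤ F xh - ((σ * (Lj jj / q) * ‖y jj - xh‖ ^ q : ℝ) : EReal) := by
  have hq2 : 2 ≤ q := hq.1
  have hq0 : 0 < q := by linarith
  have hLpos : ∀ j, 0 < Lj j := fun j => by rw [hLj]; positivity
  have hLtop : Tendsto Lj atTop atTop := by
    rw [funext hLj]
    exact (tendsto_pow_atTop_atTop_of_one_lt hτ).atTop_mul_const hL0
  by_contra! hcon
  set d : ℕ → ℝ := fun j => ‖y j - xh‖ with hd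
  have hdecr : ∀ j, ⟪f' xh, y j - xh⟫_ℝ + 1/2 * ⟪y j - xh, f'' xh (y j - xh)⟫_ℝ
      + Lj j / q * d j ^ q + (g (y j)).toReal < (g xh).toReal := by
    intro j
    have h := hinex2 j
    rw [hΘ, hΘ, ← EReal.coe_toReal (hydom j) (hgnebot _), ← EReal.coe_toReal hxh (hgnebot _),
      hϑ, hϑ] at h
    norm_cast at h
    simp only [sub_self, norm_zero, Real.zero_rpow hq0.ne', map_zero, inner_zero_right] at h
    linarith
  have hfail : ∀ j, f xh + (g xh).toReal - σ * (Lj j / q) * d j ^ q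
      < f (y j) + (g (y j)).toReal := by
    intro j
    have h := hcon j
    rw [hF, hF, ← EReal.coe_toReal (hydom j) (hgnebot _), ← EReal.coe_toReal hxh (hgnebot _)] at h
    norm_cast at h
  have hdpos : ∀ j, 0 < d j := by
    intro j
    refine norm_pos_iff.2 fun h0 => ?_
    have h := hdecr j
    simp [hd, sub_eq_zero.1 h0, Real.zero_rpow hq0.ne'] at h
  have hd0 : Tendsto d atTop (𝓝 0) := by
    set p := proxg xh
    have hmin : ∀ j, (g p).toReal - ‖xh - p‖ * (d j + ‖xh - p‖) ≤ (g (y j)).toReal := by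
      intro j
      have h1 := prox_variational_inequality hgnebot hgconv (hproxg xh) (hydom j)
      have h2 := neg_le_of_abs_le (abs_real_inner_le_norm (xh - p) (y j - p))
      have h3 : ‖y j - p‖ ≤ d j + ‖xh - p‖ := by
        simpa using norm_add_le (y j - xh) (xh - p)
      have h4 := mul_le_mul_of_nonneg_left h3 (norm_nonneg (xh - p))
      linarith
    have hlarge : Tendsto (fun j => Lj j / q) atTop atTop := hLtop.atTop_div_const hq0
    refine tendsto_zero_of_mul_rpow_le_quadratic
      (a := |(g xh).toReal - (g p).toReal + ‖xh - p‖ ^ 2|)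
      (b := ‖f' xh‖ + ‖xh - p‖) (c := 1/2 * ‖f'' xh‖) hq2 (abs_nonneg _) (by positivity)
      (by positivity) hlarge (fun j => norm_nonneg _) fun j => ?_
    have h1 := hdecr j
    have h2 := hmin j
    have h3 := neg_le_of_abs_le (abs_real_inner_le_norm (f' xh) (y j - xh))
    have h4 := neg_le_of_abs_le (abs_real_inner_le_norm (y j - xh) (f'' xh (y j - xh)))
    have h5 := mul_le_mul_of_nonneg_left ((f'' xh).le_opNorm (y j - xh))
      (norm_nonneg (y j - xh))
    have h6 := le_abs_self ((g xh).toReal - (g p).toReal + ‖xh - p‖ ^ 2)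
    simp only [hd] at h1 h2 ⊢
    nlinarith
  have hy : Tendsto y atTop (𝓝 xh) := tendsto_iff_norm_sub_tendsto_zero.2 hd0
  have hxO : xh ∈ O := hOdom hxh
  have htaylor := (taylor_second_order_isLittleO
    ((hO.eventually_mem hxO).mono hf1) (hf2 xh hxO)).comp_tendsto hy
  have hreg : Tendsto (fun j => Lj j * d j ^ (q - 2)) atTop (𝓝 0) := by
    refine Metric.tendsto_nhds.2 fun ε hε => ?_
    have hσ' : 0 < 1 - σ := sub_pos.2 hσ.2
    filter_upwards [htaylor.def (c := (1 - σ) / q * ε) (by positivity)] with j hj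
    have hrpow : d j ^ (q - 2) * d j ^ 2 = d j ^ q := by
      rw [← Real.rpow_natCast, ← Real.rpow_add (hdpos j)]
      norm_num
    rw [Real.dist_0_eq_abs,
      abs_of_nonneg (mul_nonneg (hLpos j).le (Real.rpow_nonneg (hdpos j).le _))]
    have h1 := (le_abs_self _).trans hj
    simp only [Function.comp_apply, norm_pow, norm_norm] at h1
    have h2 := hdecr j
    have h3 := hfail j
    have h4 : (1 - σ) / q * (d j ^ 2) * (Lj j * d j ^ (q - 2))
        < (1 - σ) / q * (d j ^ 2) * ε := by
      have h5 : (1 - σ) / q * (d j ^ 2) * (Lj j * d j ^ (q - 2))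
          = Lj j / q * d j ^ q - σ * (Lj j / q) * d j ^ q := by
        rw [← hrpow]; ring
      have h6 : (1 - σ) / q * (d j ^ 2) * ε = (1 - σ) / q * ε * ‖y j - xh‖ ^ 2 := by
        simp only [hd]; ring
      rw [h5, h6]
      linarith
    have := hdpos j
    exact lt_of_mul_lt_mul_left h4 (by positivity)
  have hsub : Tendsto (fun j => y j - xh) atTop (𝓝 0) := by
    simpa using hy.sub_const xh
  have hprox : Continuous proxg :=
    (prox_lipschitzWith_one hgnebot hgconv hproxg hxh).continuous
  have hstep : Tendsto (fun j => y j - (f' xh + f'' xh (y j - xh)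
      + (Lj j * d j ^ (q - 2)) • (y j - xh))) atTop (𝓝 (xh - f' xh)) := by
    have h1 := ((f'' xh).continuous.tendsto 0).comp hsub
    have h2 := hy.sub ((h1.const_add (f' xh)).add (hreg.smul hsub))
    simpa using h2
  have hres : Tendsto (fun j => ‖RL j (y j)‖) atTop (𝓝 ‖xh - proxg (xh - f' xh)‖) := by
    simp only [hRL]
    exact (hy.sub ((hprox.tendsto _).comp hstep)).norm
  have hupper : Tendsto (fun j => ϱ * Lj j * d j ^ (q - 1)) atTop (𝓝 0) := by
    have h1 := (hreg.mul hd0).const_mul ϱ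
    simp only [mul_zero] at h1
    refine h1.congr fun j => ?_
    have h2 : d j ^ (q - 1) = d j ^ (q - 2) * d j := by
      rw [← Real.rpow_add_one (hdpos j).ne']
      congr 1
      ring
    rw [h2]
    ring
  exact hrxh (le_antisymm (le_of_tendsto_of_tendsto' hres hupper hinex1) (norm_nonneg _))
end

section
/- Let {x^k}, {y^k}, {L_k} be generated by Algorithm 1. Then: (i) for each k ∈ ℕ, F(x^{k+1}) ≤ F(y^k) ≤ F(x^k) − σ(L_min/q)‖y^k − x^k‖^q; (ii) the sequence {F(x^k)} is nonincreasing and convergent, and ∑_{k=1}^∞ ‖y^k − x^k‖^q < ∞; (iii) if the level set ℒ_F(x⁰) := {x : F(x) ≤ F(x⁰)} is bounded, then the sequence {(x^k, y^k)} is bounded and the set ω(x⁰) of cluster points of {x^k} is nonempty and compact. -/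
open Filter Metric Real Set
open scoped InnerProductSpace Topology Pointwise

/-- A sequence in a bounded set of a proper space has a nonempty compact set of cluster points. -/
theorem nonempty_and_isCompact_setOf_mapClusterPt {X : Type*} [PseudoMetricSpace X] [ProperSpace X]
    {S : Set X} (hS : Bornology.IsBounded S) {x : ℕ → X} (hx : ∀ k, x k ∈ S) :
    {z : X | MapClusterPt z atTop x}.Nonempty ∧ IsCompact {z : X | MapClusterPt z atTop x} := by
  have hc : IsCompact (closure S) := hS.isCompact_closure
  constructor
  · obtain ⟨z, -, φ, hφ, hz⟩ := tendsto_subseq_of_bounded hS hx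
    exact ⟨z, hz.mapClusterPt.of_comp hφ.tendsto_atTop⟩
  · refine hc.of_isClosed_subset isClosed_setOfPred_clusterPt fun z hz => ?_
    exact mem_closure_iff_clusterPt.2
      (ClusterPt.mono hz (tendsto_principal.2 (Eventually.of_forall hx)))

/-- A sequence of nonnegative reals dominated by the decrements of a sequence bounded below
is summable. -/
theorem summable_of_le_sub_succ {a d : ℕ → ℝ} {m : ℝ} (hd : ∀ k, 0 ≤ d k)
    (hm : ∀ k, m ≤ a k) (h : ∀ k, d k ≤ a k - a (k + 1)) : Summable d := by
  refine summable_of_sum_range_le (c := a 0 - m) hd fun n => ?_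
  calc ∑ k ∈ Finset.range n, d k ≤ ∑ k ∈ Finset.range n, (a k - a (k + 1)) :=
        Finset.sum_le_sum fun k _ => h k
    _ = a 0 - a n := Finset.sum_range_sub' a n
    _ ≤ a 0 - m := by linarith [hm n]

/-- Proposition 3.1: basic properties of the sequences generated by Algorithm 1. -/
theorem algorithm_basic_properties
    {X : Type*} [NormedAddCommGroup X] [InnerProductSpace ℝ X] [FiniteDimensional ℝ X]
    -- the data of problem (1): f twice continuously differentiable on an open set O ⊇ dom g,
    -- g proper lsc convex, F = f + g bounded below
    (f : X → ℝ) (g : X → EReal) (f' : X → X) (f'' : X → X →L[ℝ] X)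
    (O : Set X) (hO : IsOpen O) (hOdom : {z : X | g z ≠ ⊤} ⊆ O)
    (hgproper : ∃ z : X, g z ≠ ⊤) (hgnebot : ∀ z : X, g z ≠ ⊥)
    (hglsc : LowerSemicontinuous g)
    (hgconv : ∀ u w : X, ∀ t : ℝ, t ∈ Set.Ioo (0:ℝ) 1 →
        g (t • u + (1 - t) • w) ≤ (t : EReal) * g u + ((1 - t : ℝ) : EReal) * g w)
    (hf1 : ∀ z ∈ O, HasGradientAt f (f' z) z)
    (hf2 : ∀ z ∈ O, HasFDerivAt f' (f'' z) z)
    (hf2c : ContinuousOn f'' O)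
    -- the proximal mapping of g
    (proxg : X → X)
    (hproxg : ∀ w z : X,
        ((1/2 * ‖proxg w - w‖ ^ 2 : ℝ) : EReal) + g (proxg w) ≤
          ((1/2 * ‖z - w‖ ^ 2 : ℝ) : EReal) + g z)
    (F : X → EReal) (hF : ∀ z : X, F z = (f z : EReal) + g z)
    (hFbdd : ∃ m : ℝ, ∀ z : X, (m : EReal) ≤ F z)
    -- Algorithm 1 parameters
    (q Lmin Lmax ϱ σ τ : ℝ)
    (hq : q ∈ Set.Icc (2:ℝ) 3) (hLmin : 0 < Lmin) (hLmm : Lmin < Lmax)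
    (hϱ : ϱ ∈ Set.Ioo (0:ℝ) 1) (hσ : σ ∈ Set.Ioo (0:ℝ) 1) (hτ : 1 < τ)
    -- the sequences generated by Algorithm 1
    (x y v : ℕ → X) (L L0 : ℕ → ℝ) (j : ℕ → ℕ)
    (hx0 : g (x 0) ≠ ⊤)
    (hL0 : ∀ k : ℕ, L0 k ∈ Set.Icc Lmin Lmax)
    (hLdef : ∀ k : ℕ, L k = τ ^ j k * L0 k)
    -- the quadratic model ϑ_k, the regularized model objective Θ_{k,L} and its KKT residual map
    (ϑ : ℕ → X → ℝ)
    (hϑ : ∀ k : ℕ, ∀ z : X, ϑ k z = f (x k) + ⟪f' (x k), z - x k⟫_ℝ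
        + 1/2 * ⟪z - x k, f'' (x k) (z - x k)⟫_ℝ)
    (Θ : ℕ → ℝ → X → EReal)
    (hΘ : ∀ k : ℕ, ∀ l : ℝ, ∀ z : X,
        Θ k l z = ((ϑ k z + l / q * ‖z - x k‖ ^ q : ℝ) : EReal) + g z)
    (Rk : ℕ → ℝ → X → X)
    (hRk : ∀ k : ℕ, ∀ l : ℝ, ∀ z : X, Rk k l z = z - proxg (z -
        (f' (x k) + f'' (x k) (z - x k) + (l * ‖z - x k‖ ^ (q - 2)) • (z - x k))))
    -- inexactness criterion and descent condition at each iteration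
    (hydom : ∀ k : ℕ, g (y k) ≠ ⊤)
    (hinex1 : ∀ k : ℕ, ‖Rk k (L k) (y k)‖ ≤ ϱ * L k * ‖y k - x k‖ ^ (q - 1))
    (hinex2 : ∀ k : ℕ, Θ k (L k) (y k) < Θ k (L k) (x k))
    (hdesc : ∀ k : ℕ, F (y k) ≤ F (x k) - ((σ * L k / q * ‖y k - x k‖ ^ q : ℝ) : EReal))
    (hv : ∀ k : ℕ, v k = Rk k (L k) (y k))
    (hxsucc : ∀ k : ℕ, x (k + 1) = if F (y k) < F (y k - v k) then y k else y k - v k)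
    -- if j_k ≥ 1, the previous trial point failed the descent test
    (hback : ∀ k : ℕ, 1 ≤ j k → ∃ yt : X, g yt ≠ ⊤ ∧
        ‖Rk k (L k / τ) yt‖ ≤ ϱ * (L k / τ) * ‖yt - x k‖ ^ (q - 1) ∧
        Θ k (L k / τ) yt < Θ k (L k / τ) (x k) ∧
        F (x k) - ((σ * (L k / τ) / q * ‖yt - x k‖ ^ q : ℝ) : EReal) < F yt) :
    -- (i)
    (∀ k : ℕ, F (x (k + 1)) ≤ F (y k) ∧
        F (y k) ≤ F (x k) - ((σ * (Lmin / q) * ‖y k - x k‖ ^ q : ℝ) : EReal)) ∧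
    -- (ii)
    ((Antitone fun k : ℕ => F (x k)) ∧
      (∃ c : ℝ, Tendsto (fun k : ℕ => F (x k)) atTop (𝓝 (c : EReal))) ∧
      Summable fun k : ℕ => ‖y k - x k‖ ^ q) ∧
    -- (iii)
    (Bornology.IsBounded {z : X | F z ≤ F (x 0)} →
      Bornology.IsBounded (Set.range fun k : ℕ => (x k, y k)) ∧
      {z : X | MapClusterPt z atTop x}.Nonempty ∧
      IsCompact {z : X | MapClusterPt z atTop x}) := by
  have hq0 : 0 < q := by linarith [hq.1]
  have hσ0 : 0 < σ := hσ.1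
  have hLk (k : ℕ) : Lmin ≤ L k := by
    rw [hLdef k]
    have h1 : 1 ≤ τ ^ j k := one_le_pow₀ hτ.le
    nlinarith [(hL0 k).1]
  have hd (k : ℕ) : 0 ≤ ‖y k - x k‖ ^ q := rpow_nonneg (norm_nonneg _) _
  have hFxy (k : ℕ) : F (x (k + 1)) ≤ F (y k) := by
    rw [hxsucc k]
    split_ifs with h
    · exact le_rfl
    · exact not_lt.1 h
  have hFyx (k : ℕ) :
      F (y k) ≤ F (x k) - ((σ * (Lmin / q) * ‖y k - x k‖ ^ q : ℝ) : EReal) := by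
    refine (hdesc k).trans (EReal.sub_le_sub le_rfl (EReal.coe_le_coe_iff.2 ?_))
    rw [mul_div_assoc]
    have := hLk k
    have := hd k
    gcongr
  obtain ⟨m, hm⟩ := hFbdd
  have hFbot (z : X) : F z ≠ ⊥ := ((EReal.bot_lt_coe m).trans_le (hm z)).ne'
  have hFtop {z : X} (hz : g z ≠ ⊤) : F z ≠ ⊤ := by
    rw [hF z]
    exact EReal.add_ne_top (EReal.coe_ne_top _) hz
  have hxtop (k : ℕ) : F (x k) ≠ ⊤ := by
    cases k with
    | zero => exact hFtop hx0
    | succ k => exact ne_top_of_le_ne_top (hFtop (hydom k)) (hFxy k)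
  have hcoe (k : ℕ) : ((F (x k)).toReal : EReal) = F (x k) :=
    EReal.coe_toReal (hxtop k) (hFbot _)
  have hdec (k : ℕ) : σ * (Lmin / q) * ‖y k - x k‖ ^ q
      ≤ (F (x k)).toReal - (F (x (k + 1))).toReal := by
    have h := (hFxy k).trans (hFyx k)
    rw [← hcoe k, ← hcoe (k + 1), ← EReal.coe_sub, EReal.coe_le_coe_iff] at h
    linarith
  have hc : 0 < σ * (Lmin / q) := by positivity
  have hanti : Antitone fun k : ℕ => (F (x k)).toReal :=
    antitone_nat_of_succ_le fun k => by
      linarith [hdec k, mul_nonneg hc.le (hd k)]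
  have hmreal (k : ℕ) : m ≤ (F (x k)).toReal := by
    rw [← EReal.coe_le_coe_iff, hcoe k]
    exact hm _
  have hFanti : Antitone fun k : ℕ => F (x k) := fun a b hab => by
    have h := EReal.coe_le_coe_iff.2 (hanti hab)
    rwa [hcoe, hcoe] at h
  refine ⟨fun k => ⟨hFxy k, hFyx k⟩, ⟨hFanti, ?_, ?_⟩, fun hbdd => ?_⟩
  · refine ⟨⨅ k, (F (x k)).toReal, ?_⟩
    have h := tendsto_atTop_ciInf hanti ⟨m, by rintro _ ⟨k, rfl⟩; exact hmreal k⟩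
    exact (EReal.tendsto_coe.2 h).congr hcoe
  · exact (summable_mul_left_iff hc.ne').1
      (summable_of_le_sub_succ (fun k => mul_nonneg hc.le (hd k)) hmreal hdec)
  · have hxmem (k : ℕ) : x k ∈ {z : X | F z ≤ F (x 0)} := hFanti (Nat.zero_le k)
    have hymem (k : ℕ) : y k ∈ {z : X | F z ≤ F (x 0)} := by
      refine ((hFyx k).trans ?_).trans (hxmem k)
      rw [← hcoe k, ← EReal.coe_sub, EReal.coe_le_coe_iff]
      linarith [mul_nonneg hc.le (hd k)]
    refine ⟨(hbdd.prod hbdd).subset ?_, ?_⟩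
    · rintro _ ⟨k, rfl⟩
      exact ⟨hxmem k, hymem k⟩
    · have : ProperSpace X := FiniteDimensional.proper_real X
      exact nonempty_and_isCompact_setOf_mapClusterPt hbdd hxmem
end

section
/- Let {x^k}, {y^k}, {L_k} be generated by Algorithm 1 and suppose Assumption 2 holds. Then there exists a constant L̂ > 0 such that L_k ≤ L̂ for all k ∈ ℕ. -/
open Filter Metric Real Set
open scoped InnerProductSpace Topology Pointwise

/-- Second-order Taylor upper bound on a convex set on which the second derivative is
Lipschitz continuous. -/
theorem taylor_upper_bound_of_lipschitz_hessian
    {X : Type*} [NormedAddCommGroup X] [InnerProductSpace ℝ X] [CompleteSpace X]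
    {f : X → ℝ} {f' : X → X} {f'' : X → X →L[ℝ] X} {S : Set X} {K : ℝ}
    (hS : Convex ℝ S) (hK : 0 ≤ K)
    (hf1 : ∀ z ∈ S, HasGradientAt f (f' z) z)
    (hf2 : ∀ z ∈ S, HasFDerivAt f' (f'' z) z)
    (hlip : ∀ a ∈ S, ∀ b ∈ S, ‖f'' a - f'' b‖ ≤ K * ‖a - b‖)
    {a b : X} (ha : a ∈ S) (hb : b ∈ S) :
    f b ≤ f a + ⟪f' a, b - a⟫_ℝ + 1/2 * ⟪b - a, f'' a (b - a)⟫_ℝ + K * ‖b - a‖ ^ 3 := by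
  set d := b - a with hd
  have hseg : ∀ s ∈ Icc (0:ℝ) 1, a + s • d ∈ S := fun s hs => hS.add_smul_sub_mem ha hb hs
  have hsegm : segment ℝ a b ⊆ S := hS.segment_subset ha hb
  have hgrad : ∀ s ∈ Icc (0:ℝ) 1,
      ‖f' (a + s • d) - f' a - f'' a (s • d)‖ ≤ K * ‖d‖ ^ 2 := by
    intro s hs
    have hmem : a + s • d ∈ segment ℝ a b := by
      rw [segment_eq_image']
      exact ⟨s, hs, rfl⟩
    have h := (convex_segment a b).norm_image_sub_le_of_norm_hasFDerivWithin_le'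
      (f := f') (f' := f'') (φ := f'' a) (C := K * ‖d‖)
      (fun w hw => (hf2 w (hsegm hw)).hasFDerivWithinAt)
      (fun w hw => by
        refine (hlip w (hsegm hw) a ha).trans ?_
        gcongr
        rw [segment_eq_image'] at hw
        obtain ⟨r, hr, rfl⟩ := hw
        simp only [add_sub_cancel_left, norm_smul, Real.norm_eq_abs, abs_of_nonneg hr.1]
        exact mul_le_of_le_one_left (norm_nonneg _) hr.2)
      (left_mem_segment ℝ a b) hmem
    rw [add_sub_cancel_left] at h
    refine h.trans ?_
    rw [norm_smul, Real.norm_eq_abs, abs_of_nonneg hs.1]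
    have h1 : s * ‖d‖ ≤ ‖d‖ := mul_le_of_le_one_left (norm_nonneg _) hs.2
    calc K * ‖d‖ * (s * ‖d‖) ≤ K * ‖d‖ * ‖d‖ := by gcongr
      _ = K * ‖d‖ ^ 2 := by ring
  let φ : ℝ → ℝ := fun s => f (a + s • d) - s * ⟪f' a, d⟫_ℝ - s ^ 2 * (1/2 * ⟪d, f'' a d⟫_ℝ)
  have hφ : ∀ s ∈ Icc (0:ℝ) 1,
      HasDerivAt φ ⟪f' (a + s • d) - f' a - f'' a (s • d), d⟫_ℝ s := by
    intro s hs
    have hline : HasDerivAt (fun s : ℝ => a + s • d) d s := by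
      simpa using ((hasDerivAt_id s).smul_const d).const_add a
    have h1 : HasDerivAt (fun s : ℝ => f (a + s • d)) ⟪f' (a + s • d), d⟫_ℝ s := by
      refine ((hf1 _ (hseg s hs)).hasFDerivAt.comp_hasDerivAt s hline).congr_deriv ?_
      simp
    have h2 := (h1.sub ((hasDerivAt_id s).mul_const ⟪f' a, d⟫_ℝ)).sub
      (((hasDerivAt_id s).pow 2).mul_const (1/2 * ⟪d, f'' a d⟫_ℝ))
    refine h2.congr_deriv ?_
    simp only [inner_sub_left, map_smul, inner_smul_left, real_inner_comm d (f'' a d)]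
    simp
    ring
  have h := (convex_Icc (0:ℝ) 1).norm_image_sub_le_of_norm_hasDerivWithin_le
    (f := φ) (C := K * ‖d‖ ^ 3) (fun s hs => (hφ s hs).hasDerivWithinAt)
    (fun s hs => by
      refine (norm_inner_le_norm _ _).trans ?_
      calc _ ≤ K * ‖d‖ ^ 2 * ‖d‖ := by gcongr; exact hgrad s hs
        _ = K * ‖d‖ ^ 3 := by ring)
    (left_mem_Icc.2 zero_le_one) (right_mem_Icc.2 zero_le_one)
  have h' := (le_abs_self _).trans h
  have hab : a + d = b := by simp [hd]
  simp only [φ, one_smul, zero_smul, add_zero, hab] at h'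
  norm_num at h'
  linarith

/-- On a bounded convex set, a Lipschitz continuous second derivative forces the function and
its first two derivatives to be bounded. -/
theorem exists_bound_of_lipschitz_hessian
    {X : Type*} [NormedAddCommGroup X] [InnerProductSpace ℝ X] [CompleteSpace X]
    {f : X → ℝ} {f' : X → X} {f'' : X → X →L[ℝ] X} {S : Set X} {K : ℝ}
    (hS : Convex ℝ S) (hSb : Bornology.IsBounded S) (hK : 0 ≤ K)
    (hf1 : ∀ z ∈ S, HasGradientAt f (f' z) z)
    (hf2 : ∀ z ∈ S, HasFDerivAt f' (f'' z) z)
    (hlip : ∀ a ∈ S, ∀ b ∈ S, ‖f'' a - f'' b‖ ≤ K * ‖a - b‖) :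
    ∃ B : ℝ, 0 ≤ B ∧ ∀ a ∈ S, |f a| ≤ B ∧ ‖f' a‖ ≤ B ∧ ‖f'' a‖ ≤ B := by
  rcases S.eq_empty_or_nonempty with rfl | ⟨a, ha⟩
  · exact ⟨0, le_rfl, by simp⟩
  set D := Metric.diam S
  have hD : 0 ≤ D := Metric.diam_nonneg
  have hdist : ∀ b ∈ S, ‖b - a‖ ≤ D := fun b hb => by
    rw [← dist_eq_norm]
    exact Metric.dist_le_diam_of_mem hSb hb ha
  set B2 := ‖f'' a‖ + K * D
  have hB2 : 0 ≤ B2 := by positivity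
  have h2 : ∀ b ∈ S, ‖f'' b‖ ≤ B2 := fun b hb => by
    have h := norm_le_norm_add_norm_sub' (f'' b) (f'' a)
    have h' := (hlip b hb a ha).trans (mul_le_mul_of_nonneg_left (hdist b hb) hK)
    exact h.trans (add_le_add le_rfl h')
  set B1 := ‖f' a‖ + B2 * D
  have hB1 : 0 ≤ B1 := by positivity
  have h1 : ∀ b ∈ S, ‖f' b‖ ≤ B1 := fun b hb => by
    have h := norm_le_norm_add_norm_sub' (f' b) (f' a)
    have h' := (hS.norm_image_sub_le_of_norm_hasFDerivWithin_le
      (fun w hw => (hf2 w hw).hasFDerivWithinAt) h2 ha hb).trans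
      (mul_le_mul_of_nonneg_left (hdist b hb) hB2)
    exact h.trans (add_le_add le_rfl h')
  have h0 : ∀ b ∈ S, |f b| ≤ |f a| + B1 * D := fun b hb => by
    have h := norm_le_norm_add_norm_sub' (f b) (f a)
    have h' := (hS.norm_image_sub_le_of_norm_hasFDerivWithin_le
      (fun w hw => (hf1 w hw).hasFDerivAt.hasFDerivWithinAt)
      (fun w hw => by simpa using h1 w hw) ha hb).trans
      (mul_le_mul_of_nonneg_left (hdist b hb) hB1)
    exact h.trans (by simpa using h')
  refine ⟨(|f a| + B1 * D) + B1 + B2, by positivity, fun b hb => ⟨?_, ?_, ?_⟩⟩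
  · linarith [h0 b hb]
  · have : 0 ≤ |f a| + B1 * D := by positivity
    linarith [h1 b hb]
  · have : 0 ≤ |f a| + B1 * D := by positivity
    linarith [h2 b hb]

/-- A regularization weight `l` is bounded whenever the model step of length `t` satisfies the
model decrease but fails the sufficient decrease test. Here `P` is the second-order model
increment, `Δf` and `Δg` are the increments of the two parts of the objective, and `A` bounds
the growth of `-(P + Δg)`. -/
theorem regularization_weight_le {q σ l t ρ K A P Δf Δg : ℝ}
    (hq : q ∈ Icc (2:ℝ) 3) (hσ : σ < 1) (hρ : 0 < ρ) (hρ1 : ρ ≤ 1) (hK : 0 ≤ K) (hA : 0 ≤ A)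
    (hl : 0 < l) (ht : 0 ≤ t)
    (hmodel : P + l / q * t ^ q + Δg < 0)
    (hgrowth : -(P + Δg) ≤ A * (1 + t ^ 2))
    (hfail : -(σ * l / q * t ^ q) < Δf + Δg)
    (htaylor : t < ρ → Δf ≤ P + K * t ^ 3) :
    l ≤ 3 * K / (1 - σ) + 3 * A * (1 / ρ ^ 2 + 1) / ρ := by
  obtain ⟨hq2, hq3⟩ := hq
  have hq0 : 0 < q := by linarith
  have hσ' : 0 < 1 - σ := by linarith
  have hlq : l / 3 ≤ l / q := div_le_div_of_nonneg_left hl.le hq0 hq3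
  have hfst : 0 ≤ 3 * K / (1 - σ) := by positivity
  have hsnd : 0 ≤ 3 * A * (1 / ρ ^ 2 + 1) / ρ := by positivity
  rcases lt_or_ge t ρ with h | h
  · have hT := htaylor h
    have hmain : (1 - σ) * (l / q) * t ^ q < K * t ^ 3 := by
      have : σ * l / q * t ^ q = σ * (l / q * t ^ q) := by ring
      nlinarith
    have htpos : 0 < t := by
      rcases ht.eq_or_lt with h0 | h0
      · rw [← h0, Real.zero_rpow hq0.ne'] at hmain
        norm_num at hmain
      · exact h0
    have htq : 0 < t ^ q := Real.rpow_pos_of_pos htpos q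
    have h3 : t ^ 3 ≤ t ^ q := by
      rw [← Real.rpow_natCast]
      exact Real.rpow_le_rpow_of_exponent_ge htpos (h.le.trans hρ1) (by norm_num; exact hq3)
    have h4 : (1 - σ) * (l / q) * t ^ q < K * t ^ q :=
      hmain.trans_le (mul_le_mul_of_nonneg_left h3 hK)
    have h5 : (1 - σ) * (l / q) < K := lt_of_mul_lt_mul_right h4 htq.le
    have h6 : (1 - σ) * (l / 3) ≤ (1 - σ) * (l / q) := mul_le_mul_of_nonneg_left hlq hσ'.le
    have h7 : l ≤ 3 * K / (1 - σ) := by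
      rw [le_div_iff₀ hσ']
      linarith
    linarith
  · have htpos : 0 < t := hρ.trans_le h
    have hpow : ρ * t ^ 2 ≤ t ^ q := by
      have hsplit : t ^ q = t ^ (q - 2) * t ^ 2 := by
        rw [← Real.rpow_natCast, ← Real.rpow_add htpos]
        norm_num
      rw [hsplit]
      gcongr
      rcases le_total t 1 with h1 | h1
      · calc ρ ≤ t ^ (1:ℝ) := by simpa using h
          _ ≤ t ^ (q - 2) := Real.rpow_le_rpow_of_exponent_ge htpos h1 (by linarith)
      · exact hρ1.trans (Real.one_le_rpow h1 (by linarith))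
    have h1 : l / 3 * (ρ * t ^ 2) ≤ l / q * t ^ q := by gcongr
    have h2 : (1:ℝ) ≤ 1 / ρ ^ 2 * t ^ 2 := by
      rw [one_div_mul_eq_div, one_le_div (by positivity)]
      gcongr
    have h3 : l / 3 * ρ * t ^ 2 ≤ A * (1 / ρ ^ 2 + 1) * t ^ 2 := by
      have : A * (1 + t ^ 2) ≤ A * (1 / ρ ^ 2 * t ^ 2 + t ^ 2) := by gcongr
      nlinarith
    have h4 := le_of_mul_le_mul_right h3 (by positivity)
    have h5 : l ≤ 3 * A * (1 / ρ ^ 2 + 1) / ρ := by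
      rw [le_div_iff₀ hρ]
      linarith
    linarith

/-- If `x` is a bounded sequence and, near each cluster point of `x`, the values `L k` are bounded
above along `x`, then `L` is bounded above. -/
theorem exists_upper_bound_of_locally_bounded_at_clusterPts
    {X : Type*} [PseudoMetricSpace X] [ProperSpace X] {x : ℕ → X} {L : ℕ → ℝ}
    (hx : Bornology.IsBounded (range x))
    (hloc : ∀ z, MapClusterPt z atTop x → ∃ C : ℝ, ∀ᶠ w in 𝓝 z, ∀ k, x k = w → L k ≤ C) :
    ∃ C : ℝ, ∀ k, L k ≤ C := by
  by_contra! hcon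
  let l : Filter ℕ := comap L atTop
  have hne : l.NeBot := by
    refine comap_neBot fun t ht => ?_
    obtain ⟨C, hC⟩ := mem_atTop_sets.1 ht
    obtain ⟨k, hk⟩ := hcon C
    exact ⟨k, hC _ hk.le⟩
  have hl : l ≤ atTop := by
    rw [← Nat.cofinite_eq_atTop, le_cofinite_iff_compl_singleton_mem]
    intro k
    refine mem_of_superset (preimage_mem_comap (Ioi_mem_atTop (L k))) fun i hi hik => ?_
    obtain rfl : i = k := hik
    exact lt_irrefl (L i) hi
  obtain ⟨z, -, hz⟩ := hx.isCompact_closure.exists_mapClusterPt (f := l) (u := x)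
    (le_principal_iff.2 (mem_map.2 (univ_mem' fun k => subset_closure (mem_range_self k))))
  obtain ⟨C, hC⟩ := hloc z (hz.mono hl)
  obtain ⟨k, hk, hkC⟩ := ((hz.frequently hC).and_eventually
    (preimage_mem_comap (Ioi_mem_atTop C))).exists
  exact absurd (hk k rfl) (not_le.2 hkC)

/-- Proposition 3.2(i): under Assumption 2, the regularization parameters L_k are
uniformly bounded above. -/
theorem regularization_parameters_bounded
    {X : Type*} [NormedAddCommGroup X] [InnerProductSpace ℝ X] [FiniteDimensional ℝ X]
    -- the data of problem (1): f twice continuously differentiable on an open set O ⊇ dom g,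
    -- g proper lsc convex, F = f + g bounded below
    (f : X → ℝ) (g : X → EReal) (f' : X → X) (f'' : X → X →L[ℝ] X)
    (O : Set X) (hO : IsOpen O) (hOdom : {z : X | g z ≠ ⊤} ⊆ O)
    (hgproper : ∃ z : X, g z ≠ ⊤) (hgnebot : ∀ z : X, g z ≠ ⊥)
    (hglsc : LowerSemicontinuous g)
    (hgconv : ∀ u w : X, ∀ t : ℝ, t ∈ Set.Ioo (0:ℝ) 1 →
        g (t • u + (1 - t) • w) ≤ (t : EReal) * g u + ((1 - t : ℝ) : EReal) * g w)
    (hf1 : ∀ z ∈ O, HasGradientAt f (f' z) z)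
    (hf2 : ∀ z ∈ O, HasFDerivAt f' (f'' z) z)
    (hf2c : ContinuousOn f'' O)
    -- the proximal mapping of g
    (proxg : X → X)
    (hproxg : ∀ w z : X,
        ((1/2 * ‖proxg w - w‖ ^ 2 : ℝ) : EReal) + g (proxg w) ≤
          ((1/2 * ‖z - w‖ ^ 2 : ℝ) : EReal) + g z)
    (F : X → EReal) (hF : ∀ z : X, F z = (f z : EReal) + g z)
    (hFbdd : ∃ m : ℝ, ∀ z : X, (m : EReal) ≤ F z)
    -- Algorithm 1 parameters
    (q Lmin Lmax ϱ σ τ : ℝ)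
    (hq : q ∈ Set.Icc (2:ℝ) 3) (hLmin : 0 < Lmin) (hLmm : Lmin < Lmax)
    (hϱ : ϱ ∈ Set.Ioo (0:ℝ) 1) (hσ : σ ∈ Set.Ioo (0:ℝ) 1) (hτ : 1 < τ)
    -- the sequences generated by Algorithm 1
    (x y v : ℕ → X) (L L0 : ℕ → ℝ) (j : ℕ → ℕ)
    (hx0 : g (x 0) ≠ ⊤)
    (hL0 : ∀ k : ℕ, L0 k ∈ Set.Icc Lmin Lmax)
    (hLdef : ∀ k : ℕ, L k = τ ^ j k * L0 k)
    -- the quadratic model ϑ_k, the regularized model objective Θ_{k,L} and its KKT residual map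
    (ϑ : ℕ → X → ℝ)
    (hϑ : ∀ k : ℕ, ∀ z : X, ϑ k z = f (x k) + ⟪f' (x k), z - x k⟫_ℝ
        + 1/2 * ⟪z - x k, f'' (x k) (z - x k)⟫_ℝ)
    (Θ : ℕ → ℝ → X → EReal)
    (hΘ : ∀ k : ℕ, ∀ l : ℝ, ∀ z : X,
        Θ k l z = ((ϑ k z + l / q * ‖z - x k‖ ^ q : ℝ) : EReal) + g z)
    (Rk : ℕ → ℝ → X → X)
    (hRk : ∀ k : ℕ, ∀ l : ℝ, ∀ z : X, Rk k l z = z - proxg (z -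
        (f' (x k) + f'' (x k) (z - x k) + (l * ‖z - x k‖ ^ (q - 2)) • (z - x k))))
    -- inexactness criterion and descent condition at each iteration
    (hydom : ∀ k : ℕ, g (y k) ≠ ⊤)
    (hinex1 : ∀ k : ℕ, ‖Rk k (L k) (y k)‖ ≤ ϱ * L k * ‖y k - x k‖ ^ (q - 1))
    (hinex2 : ∀ k : ℕ, Θ k (L k) (y k) < Θ k (L k) (x k))
    (hdesc : ∀ k : ℕ, F (y k) ≤ F (x k) - ((σ * L k / q * ‖y k - x k‖ ^ q : ℝ) : EReal))
    (hv : ∀ k : ℕ, v k = Rk k (L k) (y k))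
    (hxsucc : ∀ k : ℕ, x (k + 1) = if F (y k) < F (y k - v k) then y k else y k - v k)
    -- if j_k ≥ 1, the previous trial point failed the descent test
    (hback : ∀ k : ℕ, 1 ≤ j k → ∃ yt : X, g yt ≠ ⊤ ∧
        ‖Rk k (L k / τ) yt‖ ≤ ϱ * (L k / τ) * ‖yt - x k‖ ^ (q - 1) ∧
        Θ k (L k / τ) yt < Θ k (L k / τ) (x k) ∧
        F (x k) - ((σ * (L k / τ) / q * ‖yt - x k‖ ^ q : ℝ) : EReal) < F yt)
    -- Assumption 2: bounded level set; ∇²f locally Lipschitz on an open convex set N ⊇ ω(x⁰)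
    (hlevel : Bornology.IsBounded {z : X | F z ≤ F (x 0)})
    (N : Set X) (hNopen : IsOpen N) (hNconv : Convex ℝ N)
    (hNomega : {z : X | MapClusterPt z atTop x} ⊆ N)
    (hHloc : ∀ z ∈ N, ∃ K : ℝ, 0 < K ∧ ∃ δ : ℝ, 0 < δ ∧
        ∀ a ∈ Metric.ball z δ ∩ N, ∀ b ∈ Metric.ball z δ ∩ N,
          ‖f'' a - f'' b‖ ≤ K * ‖a - b‖) :
    ∃ Lhat : ℝ, 0 < Lhat ∧ ∀ k : ℕ, L k ≤ Lhat := by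
  obtain ⟨hσ0, hσ1⟩ := hσ
  have hτ0 : 0 < τ := by linarith
  have hLpos : ∀ k, 0 < L k := fun k => by
    rw [hLdef]
    exact mul_pos (pow_pos hτ0 _) (hLmin.trans_le (hL0 k).1)
  have hq0 : 0 < q := by linarith [hq.1]
  have hstep : ∀ k, F (x (k + 1)) ≤ F (x k) := fun k => by
    have hy : F (y k) ≤ F (x k) := by
      refine (hdesc k).trans ?_
      rw [sub_eq_add_neg, ← EReal.coe_neg]
      have h0 : ((-(σ * L k / q * ‖y k - x k‖ ^ q) : ℝ) : EReal) ≤ 0 := by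
        have := hLpos k
        exact EReal.coe_nonpos.2 (neg_nonpos.2 (by positivity))
      simpa using add_le_add_right h0 (F (x k))
    rw [hxsucc]
    split_ifs with h
    · exact hy
    · exact (not_lt.1 h).trans hy
  have hlev : ∀ k, F (x k) ≤ F (x 0) := fun k =>
    antitone_nat_of_succ_le (f := fun k => F (x k)) hstep (Nat.zero_le k)
  have hreal : ∀ z, g z ≠ ⊤ → ∃ r : ℝ, g z = r := fun z hz =>
    ⟨(g z).toReal, (EReal.coe_toReal hz (hgnebot z)).symm⟩
  obtain ⟨g0, hg0⟩ := hreal _ hx0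
  have hgx : ∀ k, ∃ r : ℝ, g (x k) = r ∧ f (x k) + r ≤ f (x 0) + g0 := fun k => by
    have h := hlev k
    rw [hF, hF, hg0] at h
    have htop : g (x k) ≠ ⊤ := fun htop => by
      rw [htop, EReal.coe_add_top, top_le_iff, ← EReal.coe_add] at h
      exact EReal.coe_ne_top _ h
    obtain ⟨r, hr⟩ := hreal _ htop
    rw [hr] at h
    exact ⟨r, hr, by exact_mod_cast h⟩
  obtain ⟨c, hc⟩ : ∃ c : ℝ, ∀ z : X, ∀ r : ℝ, g z = r → c ≤ 1/2 * ‖z‖ ^ 2 + r := by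
    have hp : g (proxg 0) ≠ ⊤ := fun htop => by
      have h := hproxg 0 (x 0)
      rw [htop, EReal.coe_add_top, hg0, top_le_iff, ← EReal.coe_add] at h
      exact EReal.coe_ne_top _ h
    obtain ⟨p, hp⟩ := hreal _ hp
    refine ⟨1/2 * ‖proxg 0‖ ^ 2 + p, fun z r hr => ?_⟩
    have h := hproxg 0 z
    rw [hp, hr, sub_zero, sub_zero] at h
    exact_mod_cast h
  have hxb : Bornology.IsBounded (range x) :=
    hlevel.subset (range_subset_iff.2 hlev)
  obtain ⟨R, hR⟩ := hxb.exists_norm_le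
  have hR' : ∀ k, ‖x k‖ ≤ R := fun k => hR _ (mem_range_self k)
  have hdomconv : Convex ℝ {z : X | g z ≠ ⊤} := by
    refine convex_iff_forall_pos.2 fun u hu w hw s t hs ht hst => ?_
    obtain ⟨gu, hu⟩ := hreal u hu
    obtain ⟨gw, hw⟩ := hreal w hw
    obtain rfl : t = 1 - s := by linarith
    have h := hgconv u w s ⟨hs, by linarith⟩
    rw [hu, hw, ← EReal.coe_mul, ← EReal.coe_mul, ← EReal.coe_add] at h
    exact ne_top_of_le_ne_top (EReal.coe_ne_top _) h
  suffices h : ∃ C : ℝ, ∀ k, L k ≤ C by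
    obtain ⟨C, hC⟩ := h
    exact ⟨C, (hLpos 0).trans_le (hC 0), hC⟩
  refine exists_upper_bound_of_locally_bounded_at_clusterPts hxb fun z hz => ?_
  have hzN : z ∈ N := hNomega hz
  obtain ⟨K, hK, δ, hδ, hlip⟩ := hHloc z hzN
  obtain ⟨ε, hε, hεN⟩ := Metric.isOpen_iff.1 hNopen z hzN
  set r := min δ ε
  have hr : 0 < r := lt_min hδ hε
  set S := Metric.ball z r ∩ {w : X | g w ≠ ⊤}
  have hSconv : Convex ℝ S := (convex_ball z r).inter hdomconv
  have hSO : S ⊆ O := inter_subset_right.trans hOdom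
  have hSlip : ∀ a ∈ S, ∀ b ∈ S, ‖f'' a - f'' b‖ ≤ K * ‖a - b‖ := by
    have hsub : S ⊆ Metric.ball z δ ∩ N := fun w hw =>
      ⟨Metric.ball_subset_ball (min_le_left _ _) hw.1,
        hεN (Metric.ball_subset_ball (min_le_right _ _) hw.1)⟩
    exact fun a ha b hb => hlip a (hsub ha) b (hsub hb)
  have hS1 : ∀ w ∈ S, HasGradientAt f (f' w) w := fun w hw => hf1 w (hSO hw)
  have hS2 : ∀ w ∈ S, HasFDerivAt f' (f'' w) w := fun w hw => hf2 w (hSO hw)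
  obtain ⟨B, hB0, hB⟩ := exists_bound_of_lipschitz_hessian hSconv
    (Metric.isBounded_ball.subset inter_subset_left) hK.le hS1 hS2 hSlip
  set ρ := min (r / 2) 1
  have hρ : 0 < ρ := lt_min (by positivity) one_pos
  set A := |f (x 0) + g0| + |c| + R ^ 2 + 2 * B + 1
  have hA : 0 ≤ A := by positivity
  set W := 3 * K / (1 - σ) + 3 * A * (1 / ρ ^ 2 + 1) / ρ
  refine ⟨max Lmax (W * τ), ?_⟩
  filter_upwards [Metric.ball_mem_nhds z (half_pos hr)]
  rintro _ hxball k rfl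
  obtain ⟨gx, hgxk, hFx⟩ := hgx k
  rcases Nat.eq_zero_or_pos (j k) with hj | hj
  · refine le_max_of_le_left ?_
    rw [hLdef, hj, pow_zero, one_mul]
    exact (hL0 k).2
  refine le_max_of_le_right ((div_le_iff₀ hτ0).1 ?_)
  obtain ⟨yt, hyt, -, hmodel, hfail⟩ := hback k hj
  obtain ⟨gy, hgy⟩ := hreal yt hyt
  have hxS : x k ∈ S :=
    ⟨Metric.ball_subset_ball (by linarith) hxball, by simp [hgxk]⟩
  obtain ⟨hb0, hb1, hb2⟩ := hB _ hxS
  rw [hΘ, hΘ, hϑ, hϑ, hgxk, hgy, ← EReal.coe_add, ← EReal.coe_add, EReal.coe_lt_coe_iff] at hmodel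
  simp only [sub_self, inner_zero_right, norm_zero, map_zero, mul_zero, add_zero,
    Real.zero_rpow hq0.ne'] at hmodel
  rw [hF, hF, hgxk, hgy, ← EReal.coe_add, ← EReal.coe_add, ← EReal.coe_sub,
    EReal.coe_lt_coe_iff] at hfail
  have hlpos : 0 < L k / τ := div_pos (hLpos k) hτ0
  set d := yt - x k with hd
  have hi1 : -(B * ‖d‖) ≤ ⟪f' (x k), d⟫_ℝ := by
    refine (abs_le.1 ((abs_real_inner_le_norm _ _).trans ?_)).1
    gcongr
  have hi2 : -(B * ‖d‖ ^ 2) ≤ ⟪d, f'' (x k) d⟫_ℝ := by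
    refine (abs_le.1 ((abs_real_inner_le_norm _ _).trans ?_)).1
    calc ‖d‖ * ‖f'' (x k) d‖ ≤ ‖d‖ * (B * ‖d‖) := by
          gcongr
          exact (f'' (x k)).le_of_opNorm_le hb2 d
      _ = B * ‖d‖ ^ 2 := by ring
  have hyn : ‖yt‖ ≤ R + ‖d‖ := by
    have h := norm_add_le (x k) d
    rw [hd, add_sub_cancel, ← hd] at h
    linarith [hR' k]
  have hyn2 : ‖yt‖ ^ 2 ≤ 2 * R ^ 2 + 2 * ‖d‖ ^ 2 := by
    have h : ‖yt‖ ^ 2 ≤ (R + ‖d‖) ^ 2 := by gcongr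
    nlinarith [sq_nonneg (R - ‖d‖)]
  refine regularization_weight_le (P := ⟪f' (x k), d⟫_ℝ + 1/2 * ⟪d, f'' (x k) d⟫_ℝ)
    (Δf := f yt - f (x k)) (Δg := gy - gx) hq hσ1 hρ (min_le_right _ _) hK.le hA hlpos
    (norm_nonneg d) (by linarith) ?_ (by linarith) fun ht => ?_
  · have hcy := hc yt gy hgy
    have h1 := le_abs_self (f (x 0) + g0)
    have h2 := neg_abs_le c
    have h3 := (abs_le.1 hb0).1
    have h4 : B * ‖d‖ ≤ B * (1/2 + 1/2 * ‖d‖ ^ 2) := by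
      gcongr
      nlinarith [sq_nonneg (‖d‖ - 1)]
    have h5 : 0 ≤ (|f (x 0) + g0| + |c| + R ^ 2 + B) * ‖d‖ ^ 2 := by positivity
    have h6 : A * (1 + ‖d‖ ^ 2) = |f (x 0) + g0| + |c| + R ^ 2 + 2 * B + 1
        + (|f (x 0) + g0| + |c| + R ^ 2 + B) * ‖d‖ ^ 2 + B * ‖d‖ ^ 2 + ‖d‖ ^ 2 := by
      simp only [A]
      ring
    linarith
  · have hyS : yt ∈ S := by
      refine ⟨?_, hyt⟩
      have h1 : dist yt (x k) < r / 2 := by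
        rw [dist_eq_norm]
        exact ht.trans_le (min_le_left _ _)
      have h2 : dist (x k) z < r / 2 := hxball
      exact (dist_triangle yt (x k) z).trans_lt (by linarith)
    have h := taylor_upper_bound_of_lipschitz_hessian hSconv hK.le hS1 hS2 hSlip hxS hyS
    rw [← hd] at h
    linarith
end

section
/- Let {x^k}, {y^k}, {v^k} be generated by Algorithm 1 and suppose Assumption 2 holds. Then v^k → 0 and r(x^k) → 0 as k → ∞, and the cluster-point set ω(x⁰) of {x^k} is a nonempty, connected, compact set with ω(x⁰) ⊆ 𝒮*. -/
open Filter Metric Real Set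
open scoped InnerProductSpace Topology Pointwise

section Auxiliary

variable {X : Type*} [NormedAddCommGroup X] [InnerProductSpace ℝ X]

private lemma convex_effective_domain {g : X → EReal} (hgnebot : ∀ z : X, g z ≠ ⊥)
    (hgconv : ∀ u w : X, ∀ t : ℝ, t ∈ Set.Ioo (0:ℝ) 1 →
        g (t • u + (1 - t) • w) ≤ (t : EReal) * g u + ((1 - t : ℝ) : EReal) * g w) :
    Convex ℝ {z : X | g z ≠ ⊤} := by
  rw [convex_iff_forall_pos]
  intro u hu w hw a b ha hb hab
  have h := hgconv u w a ⟨ha, by linarith⟩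
  obtain rfl : b = 1 - a := by linarith
  rw [← EReal.coe_toReal hu (hgnebot u), ← EReal.coe_toReal hw (hgnebot w)] at h
  exact ne_top_of_le_ne_top (by exact_mod_cast EReal.coe_ne_top _) h

private lemma prox_variational {g : X → EReal} (hgproper : ∃ z : X, g z ≠ ⊤)
    (hgnebot : ∀ z : X, g z ≠ ⊥)
    (hgconv : ∀ u w : X, ∀ t : ℝ, t ∈ Set.Ioo (0:ℝ) 1 →
        g (t • u + (1 - t) • w) ≤ (t : EReal) * g u + ((1 - t : ℝ) : EReal) * g w)
    {p w : X}
    (hp : ∀ z : X, ((1/2 * ‖p - w‖ ^ 2 : ℝ) : EReal) + g p ≤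
          ((1/2 * ‖z - w‖ ^ 2 : ℝ) : EReal) + g z) :
    g p ≠ ⊤ ∧ ∀ u : X, g u ≠ ⊤ → (g p).toReal + ⟪w - p, u - p⟫_ℝ ≤ (g u).toReal := by
  have hpt : g p ≠ ⊤ := by
    obtain ⟨z, hz⟩ := hgproper
    intro h
    have := hp z
    rw [h, ← EReal.coe_toReal hz (hgnebot z), EReal.coe_add_top, ← EReal.coe_add, top_le_iff] at this
    exact EReal.coe_ne_top _ this
  refine ⟨hpt, fun u hu => ?_⟩
  have key : ∀ t ∈ Set.Ioo (0:ℝ) 1,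
      (g p).toReal + ⟪w - p, u - p⟫_ℝ ≤ (g u).toReal + t * (1 / 2 * ‖u - p‖ ^ 2) := by
    intro t ht
    have h1 := hgconv u p t ht
    have h2 := (hp _).trans (add_le_add_right h1 _)
    rw [← EReal.coe_toReal hpt (hgnebot p), ← EReal.coe_toReal hu (hgnebot u)] at h2
    norm_cast at h2
    have e : t • u + (1 - t) • p - w = (p - w) + t • (u - p) := by
      rw [sub_smul, one_smul, smul_sub]; abel
    rw [e, norm_add_sq_real, inner_smul_right, norm_smul, mul_pow, Real.norm_eq_abs, sq_abs] at h2
    have e2 : ⟪w - p, u - p⟫_ℝ = - ⟪p - w, u - p⟫_ℝ := by rw [← inner_neg_left, neg_sub]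
    rw [e2]
    have ht0 := ht.1
    by_contra hcon
    push Not at hcon
    have := mul_lt_mul_of_pos_left hcon ht0
    nlinarith
  have hlim : Tendsto (fun t : ℝ => (g u).toReal + t * (1 / 2 * ‖u - p‖ ^ 2)) (𝓝[>] 0)
      (𝓝 ((g u).toReal + 0 * (1 / 2 * ‖u - p‖ ^ 2))) :=
    (Continuous.tendsto (by fun_prop) 0).mono_left nhdsWithin_le_nhds
  rw [zero_mul, add_zero] at hlim
  exact ge_of_tendsto hlim (by
    filter_upwards [Ioo_mem_nhdsGT (zero_lt_one (α := ℝ))] with t ht using key t ht)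

private lemma prox_nonexpansive {G : X → ℝ} {a b p r : X}
    (hp : G p + ⟪a - p, r - p⟫_ℝ ≤ G r) (hr : G r + ⟪b - r, p - r⟫_ℝ ≤ G p) :
    ‖p - r‖ ≤ ‖a - b‖ := by
  have h : ‖p - r‖ ^ 2 ≤ ⟪a - b, p - r⟫_ℝ := by
    rw [← real_inner_self_eq_norm_sq]
    simp only [inner_sub_left, inner_sub_right] at hp hr ⊢
    linarith
  have := real_inner_le_norm (a - b) (p - r)
  by_contra! hcon
  nlinarith [norm_nonneg (p - r), norm_nonneg (a - b)]

private lemma taylor_two_le {f : X → ℝ} {f' : X → X} {f'' : X → X →L[ℝ] X} {s : Set X}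
    (hs : Convex ℝ s) [CompleteSpace X]
    (hf1 : ∀ c ∈ s, HasGradientAt f (f' c) c) (hf2 : ∀ c ∈ s, HasFDerivAt f' (f'' c) c)
    {K : ℝ} (hK : 0 ≤ K) (hLip : ∀ c ∈ s, ∀ d ∈ s, ‖f'' c - f'' d‖ ≤ K * ‖c - d‖)
    {a b : X} (ha : a ∈ s) (hb : b ∈ s) :
    f b - (f a + ⟪f' a, b - a⟫_ℝ + 1/2 * ⟪b - a, f'' a (b - a)⟫_ℝ) ≤ K * ‖b - a‖ ^ 3 := by
  set e := b - a with he
  have hmem : ∀ t ∈ Set.Icc (0:ℝ) 1, a + t • e ∈ s := fun t ht =>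
    hs.add_smul_sub_mem ha hb ht
  have hgrad : ∀ t ∈ Set.Icc (0:ℝ) 1, ‖f' (a + t • e) - f' a - t • f'' a e‖ ≤ K * ‖e‖ ^ 2 := by
    intro t ht
    have h := (hs.inter (convex_closedBall a ‖e‖)).norm_image_sub_le_of_norm_hasFDerivWithin_le
      (f := fun c => f' c - f'' a c) (f' := fun c => f'' c - f'' a) (C := K * ‖e‖)
      (x := a) (y := a + t • e)
      (fun c hc => ((hf2 c hc.1).sub (f'' a).hasFDerivAt).hasFDerivWithinAt)
      (fun c hc => (hLip c hc.1 a ha).trans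
        (mul_le_mul_of_nonneg_left (by simpa [dist_eq_norm] using hc.2) hK))
      ⟨ha, by simp⟩ ⟨hmem t ht, by
        simpa [norm_smul, abs_of_nonneg ht.1] using
          mul_le_of_le_one_left (norm_nonneg e) ht.2⟩
    have e1 : f' (a + t • e) - f' a - t • f'' a e
        = f' (a + t • e) - f'' a (a + t • e) - (f' a - f'' a a) := by
      rw [map_add, map_smul]; abel
    rw [e1]
    refine h.trans ?_
    rw [add_sub_cancel_left, norm_smul, Real.norm_eq_abs, abs_of_nonneg ht.1]
    have : t * ‖e‖ ≤ ‖e‖ := mul_le_of_le_one_left (norm_nonneg e) ht.2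
    nlinarith [mul_le_mul_of_nonneg_left this (mul_nonneg hK (norm_nonneg e))]
  have hder : ∀ t ∈ Set.Icc (0:ℝ) 1, HasDerivWithinAt
      (fun t : ℝ => f (a + t • e) - t * ⟪f' a, e⟫_ℝ - t ^ 2 * (1/2 * ⟪e, f'' a e⟫_ℝ))
      (⟪f' (a + t • e) - f' a - t • f'' a e, e⟫_ℝ) (Set.Icc (0:ℝ) 1) t := by
    intro t ht
    have h1 : HasDerivAt (fun t : ℝ => a + t • e) e t := by
      simpa using ((hasDerivAt_id t).smul_const e).const_add a
    have h2 := (hf1 _ (hmem t ht)).hasFDerivAt.comp_hasDerivAt t h1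
    have h3 := (h2.sub ((hasDerivAt_id t).mul_const ⟪f' a, e⟫_ℝ)).sub
      (((hasDerivAt_id t).pow 2).mul_const (1/2 * ⟪e, f'' a e⟫_ℝ))
    refine (h3.congr_deriv ?_).hasDerivWithinAt
    simp only [InnerProductSpace.toDual_apply_apply, real_inner_comm e, inner_sub_right,
      inner_smul_right, id]
    norm_num
    ring
  have h := norm_image_sub_le_of_norm_deriv_le_segment_01' (C := K * ‖e‖ ^ 3) hder (by
    intro t ht
    refine (norm_inner_le_norm _ _).trans ?_
    have := mul_le_mul_of_nonneg_right (hgrad t ⟨ht.1, ht.2.le⟩) (norm_nonneg e)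
    nlinarith)
  have h' := (le_abs_self _).trans h
  simp only [one_smul, zero_smul, add_zero, he, add_sub_cancel] at h'
  linarith

private lemma exists_lower_bound_of_hessian_bound {f : X → ℝ} {f' : X → X}
    {f'' : X → X →L[ℝ] X} {s : Set X} (hs : Convex ℝ s) [CompleteSpace X]
    (hf1 : ∀ c ∈ s, HasGradientAt f (f' c) c) (hf2 : ∀ c ∈ s, HasFDerivAt f' (f'' c) c)
    {B : ℝ} (hB : ∀ c ∈ s, ‖f'' c‖ ≤ B) (hbdd : Bornology.IsBounded s) :
    ∃ m : ℝ, ∀ c ∈ s, m ≤ f c := by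
  rcases s.eq_empty_or_nonempty with rfl | ⟨a, ha⟩
  · exact ⟨0, by simp⟩
  have hB0 : 0 ≤ B := (norm_nonneg _).trans (hB a ha)
  obtain ⟨ρ, hρ⟩ := isBounded_iff.1 hbdd
  have hdist : ∀ c ∈ s, ‖c - a‖ ≤ ρ := fun c hc => by
    simpa [dist_eq_norm] using hρ hc ha
  have hgrad : ∀ c ∈ s, ‖f' c‖ ≤ ‖f' a‖ + B * ρ := by
    intro c hc
    have h := hs.norm_image_sub_le_of_norm_hasFDerivWithin_le
      (fun d hd => (hf2 d hd).hasFDerivWithinAt) hB ha hc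
    have h1 := mul_le_mul_of_nonneg_left (hdist c hc) hB0
    have h2 := norm_sub_norm_le (f' c) (f' a)
    linarith
  refine ⟨f a - (‖f' a‖ + B * ρ) * ρ, fun c hc => ?_⟩
  have h := hs.norm_image_sub_le_of_norm_hasFDerivWithin_le (f := f)
      (fun d hd => (hf1 d hd).hasFDerivAt.hasFDerivWithinAt)
      (fun d hd => by simpa using hgrad d hd) ha hc
  have h1 := mul_le_mul_of_nonneg_left (hdist c hc) ((norm_nonneg _).trans (hgrad c hc))
  have h2 := (abs_le.1 h).1
  linarith

private lemma lt_of_regularized_decrease {q C ε l d : ℝ} (hq : q ∈ Set.Icc (2:ℝ) 3) (hε : 0 < ε)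
    (hε1 : ε ≤ 1) (hC : 0 ≤ C) (hl0 : 0 < l)
    (h : l / q * d ^ q ≤ C * (1 + d + d ^ 2)) (hl : 3 * C * q / ε ^ 3 < l) : d < ε := by
  by_contra! hd
  have hd0 : 0 < d := hε.trans_le hd
  have hq0 : 0 < q := by linarith [hq.1]
  have h1 : ε * d ^ 2 ≤ d ^ q := by
    have e1 : (1:ℝ) ≤ d / ε := (one_le_div hε).2 hd
    have e2 : (d / ε) ^ (2:ℝ) ≤ (d / ε) ^ q := Real.rpow_le_rpow_of_exponent_le e1 hq.1
    have e3 : ε ^ (3:ℝ) ≤ ε ^ q := Real.rpow_le_rpow_of_exponent_ge hε hε1 hq.2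
    have e4 : d ^ q = ε ^ q * (d / ε) ^ q := by
      rw [← Real.mul_rpow hε.le (by positivity)]; congr 1; field_simp
    rw [e4]
    calc ε * d ^ 2 = ε ^ (3:ℝ) * (d / ε) ^ (2:ℝ) := by
          norm_cast; field_simp
      _ ≤ _ := by gcongr
  have h2 : C * (1 + d + d ^ 2) ≤ C * (3 * d ^ 2 / ε ^ 2) := by
    apply mul_le_mul_of_nonneg_left _ hC
    rw [le_div_iff₀ (by positivity)]
    have : ε * d ≤ d := mul_le_of_le_one_left hd0.le hε1
    have : ε ^ 2 ≤ d ^ 2 := by gcongr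
    have : ε ^ 2 * d ≤ d ^ 2 := by nlinarith
    have : ε ^ 2 ≤ 1 := by nlinarith
    nlinarith [mul_le_mul_of_nonneg_right this (sq_nonneg d)]
  have h3 : l / q * (ε * d ^ 2) ≤ C * (3 * d ^ 2 / ε ^ 2) :=
    (mul_le_mul_of_nonneg_left h1 (by positivity)).trans (h.trans h2)
  rw [div_lt_iff₀ (by positivity)] at hl
  have h4 : l * ε ^ 3 * d ^ 2 ≤ 3 * C * q * d ^ 2 := by
    field_simp at h3
    nlinarith [mul_pos hd0 hd0]
  have := le_of_mul_le_mul_right h4 (by positivity)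
  linarith

private lemma exists_bound_of_rejected_step [CompleteSpace X] {f : X → ℝ} {f' : X → X}
    {f'' : X → X →L[ℝ] X} {G : X → ℝ} {D : Set X} (hD : Convex ℝ D)
    (hf1 : ∀ c ∈ D, HasGradientAt f (f' c) c) (hf2 : ∀ c ∈ D, HasFDerivAt f' (f'' c) c)
    {z : X} (hfz : ContinuousAt f z) (hfz' : ContinuousAt f' z) (hfz'' : ContinuousAt f'' z)
    {K δ : ℝ} (hK : 0 ≤ K) (hδ : 0 < δ)
    (hLip : ∀ c ∈ D ∩ ball z δ, ∀ d ∈ D ∩ ball z δ, ‖f'' c - f'' d‖ ≤ K * ‖c - d‖)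
    {α β : ℝ} (hβ : 0 ≤ β) (hG : ∀ u ∈ D, -α - β * ‖u - z‖ ≤ G u)
    {q σ : ℝ} (hq : q ∈ Set.Icc (2:ℝ) 3) (hσ : σ < 1) (c : ℝ) :
    ∃ M : ℝ, ∀ᶠ a in 𝓝 z, a ∈ D → f a + G a ≤ c → ∀ l b, b ∈ D → 0 < l →
      (f a + ⟪f' a, b - a⟫_ℝ + 1/2 * ⟪b - a, f'' a (b - a)⟫_ℝ) + l / q * ‖b - a‖ ^ q + G b
        < f a + G a →
      f a + G a - σ * l / q * ‖b - a‖ ^ q < f b + G b → l ≤ M := by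
  have hq0 : 0 < q := by linarith [hq.1]
  set C : ℝ := |c| + (|f z| + 1) + |α| + β + (‖f' z‖ + 1) + (‖f'' z‖ + 1) with hCdef
  have hC : 0 ≤ C := by positivity
  set ε : ℝ := min 1 (δ / 2)
  have hε : 0 < ε := by positivity
  refine ⟨max (3 * C * q / ε ^ 3) (q * K / (1 - σ)), ?_⟩
  have n1 : ∀ᶠ a in 𝓝 z, |f a| < |f z| + 1 :=
    hfz.abs.eventually_lt_const (by linarith)
  have n2 : ∀ᶠ a in 𝓝 z, ‖f' a‖ < ‖f' z‖ + 1 := hfz'.norm.eventually_lt_const (by linarith)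
  have n3 : ∀ᶠ a in 𝓝 z, ‖f'' a‖ < ‖f'' z‖ + 1 := hfz''.norm.eventually_lt_const (by linarith)
  filter_upwards [n1, n2, n3, ball_mem_nhds z hε] with a h1 h2 h3 h4 haD hac l b hbD hl hmod hrej
  by_contra! hcon
  obtain ⟨hl1, hl2⟩ := max_lt_iff.1 hcon
  set d := ‖b - a‖ with hd
  have hd0 : 0 ≤ d := norm_nonneg _
  have haz : ‖a - z‖ < ε := by simpa [dist_eq_norm] using h4
  have hbz : ‖b - z‖ ≤ d + ‖a - z‖ := by
    simpa using norm_add_le (b - a) (a - z)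
  have hmodel : l / q * d ^ q ≤ C * (1 + d + d ^ 2) := by
    have i1 := (abs_le.1 (abs_real_inner_le_norm (f' a) (b - a))).1
    have i2 : -(‖f'' a‖ * d * d) ≤ ⟪b - a, f'' a (b - a)⟫_ℝ := by
      have := (abs_le.1 (abs_real_inner_le_norm (b - a) (f'' a (b - a)))).1
      have := mul_le_mul_of_nonneg_left ((f'' a).le_opNorm (b - a)) hd0
      nlinarith
    have i3 : ‖f' a‖ * d ≤ (‖f' z‖ + 1) * d := by gcongr
    have i4 : ‖f'' a‖ * d * d ≤ (‖f'' z‖ + 1) * d * d := by gcongr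
    have i5 := hG b hbD
    have i6 : β * ‖b - z‖ ≤ β * (d + 1) :=
      mul_le_mul_of_nonneg_left (by linarith [min_le_left 1 (δ / 2)]) hβ
    have i7 := le_abs_self c
    have i8 := le_abs_self α
    have i9 := neg_abs_le (f a)
    have k1 : l / q * d ^ q ≤ (|c| + (|f z| + 1) + |α| + β) + (β + (‖f' z‖ + 1)) * d
        + (‖f'' z‖ + 1) * d ^ 2 := by nlinarith [norm_nonneg (f'' z), mul_nonneg hd0 hd0]
    have k2 : |c| + (|f z| + 1) + |α| + β ≤ C := by
      rw [hCdef]; linarith [norm_nonneg (f'' z), norm_nonneg (f' z)]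
    have k3 : (β + (‖f' z‖ + 1)) * d ≤ C * d := by
      apply mul_le_mul_of_nonneg_right _ hd0
      rw [hCdef]; linarith [norm_nonneg (f'' z), abs_nonneg c, abs_nonneg (f z), abs_nonneg α]
    have k4 : (‖f'' z‖ + 1) * d ^ 2 ≤ C * d ^ 2 := by
      apply mul_le_mul_of_nonneg_right _ (sq_nonneg d)
      rw [hCdef]; linarith [norm_nonneg (f' z), abs_nonneg c, abs_nonneg (f z), abs_nonneg α]
    linarith
  have hdε := lt_of_regularized_decrease hq hε (min_le_left _ _) hC hl hmodel hl1
  have hεδ : ε ≤ δ / 2 := min_le_right _ _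
  have htaylor := taylor_two_le (hD.inter (convex_ball z δ)) (fun c hc => hf1 c hc.1)
    (fun c hc => hf2 c hc.1) hK hLip
    (a := a) (b := b) ⟨haD, by simp only [mem_ball, dist_eq_norm]; linarith⟩
    ⟨hbD, by simp only [mem_ball, dist_eq_norm]; linarith⟩
  have hdpos : 0 < d := by
    rcases hd0.eq_or_lt with h0 | h0
    · have hba : b = a := by rw [← sub_eq_zero, ← norm_eq_zero]; exact h0.symm
      subst hba
      rw [← h0, Real.zero_rpow hq0.ne'] at hmod
      simp at hmod
    · exact h0
  have hcube : d ^ 3 ≤ d ^ q := by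
    rw [← Real.rpow_natCast d 3]
    exact Real.rpow_le_rpow_of_exponent_ge hdpos (hdε.le.trans (min_le_left _ _)) (by simpa using hq.2)
  have hdq : 0 < d ^ q := Real.rpow_pos_of_pos hdpos q
  have hfin : (1 - σ) * l / q * d ^ q < K * d ^ q := by
    have := mul_le_mul_of_nonneg_left hcube hK
    have e : (1 - σ) * l / q * d ^ q = l / q * d ^ q - σ * l / q * d ^ q := by ring
    rw [e]
    linarith
  have h5 := lt_of_mul_lt_mul_right hfin hdq.le
  rw [div_lt_iff₀ hq0] at h5
  rw [div_lt_iff₀ (by linarith)] at hl2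
  nlinarith

end Auxiliary

private lemma isConnected_mapClusterPt {X : Type*} [MetricSpace X] {x : ℕ → X} {S : Set X}
    (hS : IsCompact S) (hx : ∀ k, x k ∈ S)
    (hstep : Tendsto (fun k => dist (x (k + 1)) (x k)) atTop (𝓝 0)) :
    IsConnected {z : X | MapClusterPt z atTop x} ∧ IsCompact {z : X | MapClusterPt z atTop x} := by
  set ω := {z : X | MapClusterPt z atTop x}
  have hclosed : IsClosed ω := isClosed_setOfPred_clusterPt
  have hsub : ω ⊆ S := fun z hz => by
    rw [← hS.isClosed.closure_eq, mem_closure_iff_nhds]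
    intro t ht
    obtain ⟨k, hk⟩ := (mapClusterPt_iff_frequently.1 hz t ht).exists
    exact ⟨x k, hk, hx k⟩
  have hcomp : IsCompact ω := hS.of_isClosed_subset hclosed hsub
  have hnear : ∀ W : Set X, IsOpen W → ω ⊆ W → ∀ᶠ k in atTop, x k ∈ W := by
    intro W hW hsubW
    by_contra hcon
    obtain ⟨z, hz, hcl⟩ := (hS.diff hW).exists_mapClusterPt_of_frequently
      (l := atTop) (f := x) ((not_eventually.1 hcon).mono fun k hk => ⟨hx k, hk⟩)
    exact hz.2 (hsubW hcl)
  refine ⟨⟨?_, ?_⟩, hcomp⟩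
  · obtain ⟨z, -, hz⟩ := hS.exists_mapClusterPt_of_frequently
      (l := atTop) (f := x) (Frequently.of_forall hx)
    exact ⟨z, hz⟩
  rw [isPreconnected_iff_subset_of_fully_disjoint_closed hclosed]
  intro A B hA hB hAB hdisj
  by_contra! hcon
  obtain ⟨⟨b, hbω, hbA⟩, ⟨a, haω, haB⟩⟩ := And.imp not_subset.1 not_subset.1 hcon
  have ha : a ∈ ω ∩ A := ⟨haω, (hAB haω).resolve_right haB⟩
  have hb : b ∈ ω ∩ B := ⟨hbω, (hAB hbω).resolve_left hbA⟩
  obtain ⟨δ, hδ, hth⟩ := (hdisj.mono (inter_subset_right (s := ω))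
    (inter_subset_right (s := ω))).exists_thickenings (hcomp.inter_right hA) (hclosed.inter hB)
  have hev := hnear (thickening (δ / 2) (ω ∩ A) ∪ thickening (δ / 2) (ω ∩ B))
    (isOpen_thickening.union isOpen_thickening) (fun z hz => (hAB hz).imp
      (fun h => self_subset_thickening (half_pos hδ) _ ⟨hz, h⟩)
      (fun h => self_subset_thickening (half_pos hδ) _ ⟨hz, h⟩))
  obtain ⟨k₀, hk₀⟩ := eventually_atTop.1
    (hev.and (hstep.eventually_lt_const (half_pos hδ)))
  have hfreq : ∀ {p : X} {E : Set X}, p ∈ ω ∩ E →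
      ∃ k ≥ k₀, x k ∈ thickening (δ / 2) (ω ∩ E) := by
    intro p E hp
    have := (mapClusterPt_iff_frequently.1 hp.1) _
      (isOpen_thickening.mem_nhds (self_subset_thickening (half_pos hδ) _ hp))
    exact frequently_atTop.1 this k₀
  obtain ⟨k₁, hk₁, hxk₁⟩ := hfreq ha
  have hstay : ∀ k ≥ k₁, x k ∈ thickening (δ / 2) (ω ∩ A) := by
    intro k hk
    induction k, hk using Nat.le_induction with
    | base => exact hxk₁
    | succ k hk ih =>
      refine ((hk₀ (k + 1) (by omega)).1).resolve_right fun hB' => ?_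
      obtain ⟨u, hu, hxu⟩ := mem_thickening_iff.1 ih
      have hd := (hk₀ k (by omega)).2
      refine disjoint_left.1 hth (mem_thickening_iff.2 ⟨u, hu, ?_⟩)
        (thickening_mono (by linarith) _ hB')
      linarith [dist_triangle (x (k + 1)) (x k) u]
  have hBfreq := (mapClusterPt_iff_frequently.1 hb.1) _
      (isOpen_thickening.mem_nhds (self_subset_thickening (half_pos hδ) _ hb))
  obtain ⟨k, hk, hxk⟩ := frequently_atTop.1 hBfreq k₁
  exact disjoint_left.1 hth (thickening_mono (by linarith) _ (hstay k hk))
    (thickening_mono (by linarith) _ hxk)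

/-- Proposition 3.2(ii)-(iii): under Assumption 2, v^k → 0, r(x^k) → 0, and the cluster-point
set ω(x⁰) is a nonempty connected compact subset of the stationary set 𝒮*. -/
theorem residuals_vanish_and_cluster_set_properties
    {X : Type*} [NormedAddCommGroup X] [InnerProductSpace ℝ X] [FiniteDimensional ℝ X]
    -- the data of problem (1): f twice continuously differentiable on an open set O ⊇ dom g,
    -- g proper lsc convex, F = f + g bounded below
    (f : X → ℝ) (g : X → EReal) (f' : X → X) (f'' : X → X →L[ℝ] X)
    (O : Set X) (hO : IsOpen O) (hOdom : {z : X | g z ≠ ⊤} ⊆ O)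
    (hgproper : ∃ z : X, g z ≠ ⊤) (hgnebot : ∀ z : X, g z ≠ ⊥)
    (hglsc : LowerSemicontinuous g)
    (hgconv : ∀ u w : X, ∀ t : ℝ, t ∈ Set.Ioo (0:ℝ) 1 →
        g (t • u + (1 - t) • w) ≤ (t : EReal) * g u + ((1 - t : ℝ) : EReal) * g w)
    (hf1 : ∀ z ∈ O, HasGradientAt f (f' z) z)
    (hf2 : ∀ z ∈ O, HasFDerivAt f' (f'' z) z)
    (hf2c : ContinuousOn f'' O)
    -- the proximal mapping of g
    (proxg : X → X)
    (hproxg : ∀ w z : X,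
        ((1/2 * ‖proxg w - w‖ ^ 2 : ℝ) : EReal) + g (proxg w) ≤
          ((1/2 * ‖z - w‖ ^ 2 : ℝ) : EReal) + g z)
    (F : X → EReal) (hF : ∀ z : X, F z = (f z : EReal) + g z)
    (hFbdd : ∃ m : ℝ, ∀ z : X, (m : EReal) ≤ F z)
    -- Algorithm 1 parameters
    (q Lmin Lmax ϱ σ τ : ℝ)
    (hq : q ∈ Set.Icc (2:ℝ) 3) (hLmin : 0 < Lmin) (hLmm : Lmin < Lmax)
    (hϱ : ϱ ∈ Set.Ioo (0:ℝ) 1) (hσ : σ ∈ Set.Ioo (0:ℝ) 1) (hτ : 1 < τ)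
    -- the sequences generated by Algorithm 1
    (x y v : ℕ → X) (L L0 : ℕ → ℝ) (j : ℕ → ℕ)
    (hx0 : g (x 0) ≠ ⊤)
    (hL0 : ∀ k : ℕ, L0 k ∈ Set.Icc Lmin Lmax)
    (hLdef : ∀ k : ℕ, L k = τ ^ j k * L0 k)
    -- the quadratic model ϑ_k, the regularized model objective Θ_{k,L} and its KKT residual map
    (ϑ : ℕ → X → ℝ)
    (hϑ : ∀ k : ℕ, ∀ z : X, ϑ k z = f (x k) + ⟪f' (x k), z - x k⟫_ℝ
        + 1/2 * ⟪z - x k, f'' (x k) (z - x k)⟫_ℝ)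
    (Θ : ℕ → ℝ → X → EReal)
    (hΘ : ∀ k : ℕ, ∀ l : ℝ, ∀ z : X,
        Θ k l z = ((ϑ k z + l / q * ‖z - x k‖ ^ q : ℝ) : EReal) + g z)
    (Rk : ℕ → ℝ → X → X)
    (hRk : ∀ k : ℕ, ∀ l : ℝ, ∀ z : X, Rk k l z = z - proxg (z -
        (f' (x k) + f'' (x k) (z - x k) + (l * ‖z - x k‖ ^ (q - 2)) • (z - x k))))
    -- inexactness criterion and descent condition at each iteration
    (hydom : ∀ k : ℕ, g (y k) ≠ ⊤)
    (hinex1 : ∀ k : ℕ, ‖Rk k (L k) (y k)‖ ≤ ϱ * L k * ‖y k - x k‖ ^ (q - 1))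
    (hinex2 : ∀ k : ℕ, Θ k (L k) (y k) < Θ k (L k) (x k))
    (hdesc : ∀ k : ℕ, F (y k) ≤ F (x k) - ((σ * L k / q * ‖y k - x k‖ ^ q : ℝ) : EReal))
    (hv : ∀ k : ℕ, v k = Rk k (L k) (y k))
    (hxsucc : ∀ k : ℕ, x (k + 1) = if F (y k) < F (y k - v k) then y k else y k - v k)
    -- if j_k ≥ 1, the previous trial point failed the descent test
    (hback : ∀ k : ℕ, 1 ≤ j k → ∃ yt : X, g yt ≠ ⊤ ∧
        ‖Rk k (L k / τ) yt‖ ≤ ϱ * (L k / τ) * ‖yt - x k‖ ^ (q - 1) ∧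
        Θ k (L k / τ) yt < Θ k (L k / τ) (x k) ∧
        F (x k) - ((σ * (L k / τ) / q * ‖yt - x k‖ ^ q : ℝ) : EReal) < F yt)
    -- Assumption 2: bounded level set; ∇²f locally Lipschitz on an open convex set N ⊇ ω(x⁰)
    (hlevel : Bornology.IsBounded {z : X | F z ≤ F (x 0)})
    (N : Set X) (hNopen : IsOpen N) (hNconv : Convex ℝ N)
    (hNomega : {z : X | MapClusterPt z atTop x} ⊆ N)
    (hHloc : ∀ z ∈ N, ∃ K : ℝ, 0 < K ∧ ∃ δ : ℝ, 0 < δ ∧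
        ∀ a ∈ Metric.ball z δ ∩ N, ∀ b ∈ Metric.ball z δ ∩ N,
          ‖f'' a - f'' b‖ ≤ K * ‖a - b‖) :
    Tendsto v atTop (𝓝 0) ∧
    Tendsto (fun k : ℕ => ‖x k - proxg (x k - f' (x k))‖) atTop (𝓝 0) ∧
    IsConnected {z : X | MapClusterPt z atTop x} ∧
    IsCompact {z : X | MapClusterPt z atTop x} ∧
    {z : X | MapClusterPt z atTop x} ⊆ {z : X | -f' z ∈ ESubdiff g z} := by
  have hq0 : 0 < q := by linarith [hq.1]
  have hD := convex_effective_domain hgnebot hgconv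
  have hp := fun w => prox_variational hgproper hgnebot hgconv (hproxg w)
  set G : X → ℝ := fun z => (g z).toReal with hG
  have hFG : ∀ z, g z ≠ ⊤ → F z = ((f z + G z : ℝ) : EReal) := fun z hz => by
    rw [hF, EReal.coe_add, hG, EReal.coe_toReal hz (hgnebot z)]
  have hproxLip : ∀ a b, ‖proxg a - proxg b‖ ≤ ‖a - b‖ := fun a b =>
    prox_nonexpansive (G := G) ((hp a).2 _ (hp b).1) ((hp b).2 _ (hp a).1)
  have hproxcont : Continuous proxg :=
    (LipschitzWith.of_dist_le_mul (K := 1) fun a b => by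
      simpa [dist_eq_norm] using hproxLip a b).continuous
  have hLmink : ∀ k, Lmin ≤ L k := fun k => by
    rw [hLdef]
    have h1 : 1 ≤ τ ^ j k := one_le_pow₀ hτ.le
    have h2 := (hL0 k).1
    nlinarith
  have hLpos : ∀ k, 0 < L k := fun k => hLmin.trans_le (hLmink k)
  have hyv : ∀ k, g (y k - v k) ≠ ⊤ := fun k => by
    rw [hv, hRk, sub_sub_cancel]
    exact (hp _).1
  have hxD : ∀ k, g (x k) ≠ ⊤ := by
    rintro (_ | k)
    · exact hx0
    · rw [hxsucc]
      split_ifs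
      · exact hydom k
      · exact hyv k
  set φ : ℕ → ℝ := fun k => f (x k) + G (x k) with hφ
  have hdecr : ∀ k, φ (k + 1) ≤ φ k - σ * L k / q * ‖y k - x k‖ ^ q := by
    intro k
    have h1 : F (x (k + 1)) ≤ F (y k) := by
      rw [hxsucc]
      split_ifs with h
      · exact le_rfl
      · exact not_lt.1 h
    have h2 := h1.trans (hdesc k)
    rw [hFG _ (hxD _), hFG _ (hxD _)] at h2
    exact_mod_cast h2
  have hstepnonneg : ∀ k, 0 ≤ σ * L k / q * ‖y k - x k‖ ^ q := fun k => by
    have := hLpos k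
    have := hσ.1
    positivity
  have hanti : Antitone φ := antitone_nat_of_succ_le fun k => by
    linarith [hdecr k, hstepnonneg k]
  have hφbdd : BddBelow (range φ) := by
    obtain ⟨m, hm⟩ := hFbdd
    refine ⟨m, ?_⟩
    rintro _ ⟨k, rfl⟩
    have := hm (x k)
    rw [hFG _ (hxD k)] at this
    exact_mod_cast this
  have hd : Tendsto (fun k => ‖y k - x k‖) atTop (𝓝 0) := by
    have hlim := tendsto_atTop_ciInf hanti hφbdd
    have hdiff := hlim.sub (hlim.comp (tendsto_add_atTop_nat 1))
    rw [sub_self] at hdiff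
    have hpow : Tendsto (fun k => ‖y k - x k‖ ^ q) atTop (𝓝 0) := by
      have hc : 0 < σ * Lmin / q := by
        have := hσ.1
        positivity
      have hdiff' := hdiff.div_const (σ * Lmin / q)
      rw [zero_div] at hdiff'
      refine squeeze_zero (fun k => by positivity) (fun k => ?_) hdiff'
      rw [le_div_iff₀ hc]
      have h1 : σ * Lmin / q ≤ σ * L k / q := by
        have := hσ.1
        have := hLmink k
        gcongr
      have h2 := mul_le_mul_of_nonneg_right h1 (by positivity : 0 ≤ ‖y k - x k‖ ^ q)
      have h3 := hdecr k
      simp only [Function.comp_apply]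
      linarith
    have h := hpow.rpow_const (p := 1 / q) (Or.inr (by positivity))
    rw [Real.zero_rpow (by positivity)] at h
    refine h.congr fun k => ?_
    rw [← Real.rpow_mul (norm_nonneg _), mul_one_div_cancel hq0.ne', Real.rpow_one]
  have hS : IsCompact (closure {z : X | F z ≤ F (x 0)}) := hlevel.isCompact_closure
  have hxS : ∀ k, x k ∈ closure {z : X | F z ≤ F (x 0)} := fun k => by
    refine subset_closure ?_
    simp only [mem_ofPred_eq]
    rw [hFG _ (hxD _), hFG _ (hxD _)]
    exact_mod_cast hanti (Nat.zero_le k)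
  have hloc : ∀ z ∈ N, ∃ K : ℝ, 0 ≤ K ∧ ∃ δ : ℝ, 0 < δ ∧ ∀ a ∈ ball z δ, ∀ b ∈ ball z δ,
      ‖f'' a - f'' b‖ ≤ K * ‖a - b‖ := by
    intro z hz
    obtain ⟨K, hK, δ, hδ, h⟩ := hHloc z hz
    obtain ⟨ε, hε, hball⟩ := Metric.isOpen_iff.1 hNopen z hz
    refine ⟨K, hK.le, min δ ε, lt_min hδ hε, fun a ha b hb => h a ⟨?_, ?_⟩ b ⟨?_, ?_⟩⟩
    · exact ball_subset_ball (min_le_left _ _) ha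
    · exact hball (ball_subset_ball (min_le_right _ _) ha)
    · exact ball_subset_ball (min_le_left _ _) hb
    · exact hball (ball_subset_ball (min_le_right _ _) hb)
  have homegaN : ∀ U : Ultrafilter ℕ, ↑U ≤ (atTop : Filter ℕ) → ∀ z, Tendsto x U (𝓝 z) → z ∈ N :=
    fun U hU z hz => hNomega (mapClusterPt_iff_ultrafilter.2 ⟨U, hU, hz⟩)
  -- `f` is not assumed lower semicontinuous: near a cluster point the Hessian bound keeps `f`
  -- bounded below on `dom g`, so that `g` stays bounded along the iterates.
  have hlimdom : ∀ U : Ultrafilter ℕ, ↑U ≤ (atTop : Filter ℕ) →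
      ∀ z, Tendsto x U (𝓝 z) → g z ≠ ⊤ := by
    intro U hU z hz
    obtain ⟨K, hK, δ, hδ, hLip⟩ := hloc z (homegaN U hU z hz)
    obtain ⟨m, hm⟩ := exists_lower_bound_of_hessian_bound (f := f) (f' := f') (f'' := f'')
      (B := ‖f'' z‖ + K * δ)
      (hD.inter (convex_ball z δ)) (fun c hc => hf1 c (hOdom hc.1))
      (fun c hc => hf2 c (hOdom hc.1)) (fun c hc => by
        have h1 := hLip c hc.2 z (mem_ball_self hδ)
        have h2 : ‖c - z‖ ≤ δ := by simpa [dist_eq_norm] using (mem_ball.1 hc.2).le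
        have h3 := norm_sub_norm_le (f'' c) (f'' z)
        have h4 := mul_le_mul_of_nonneg_left h2 hK
        linarith) (isBounded_ball.subset inter_subset_right)
    have hclosed : IsClosed (g ⁻¹' Set.Iic ((φ 0 - m : ℝ) : EReal)) :=
      hglsc.isClosed_preimage _
    have hmem : z ∈ g ⁻¹' Set.Iic ((φ 0 - m : ℝ) : EReal) := by
      refine hclosed.mem_of_tendsto hz ?_
      filter_upwards [hz.eventually (ball_mem_nhds z hδ)] with k hk
      have h1 := hm (x k) ⟨hxD k, hk⟩
      have h2 := hanti (Nat.zero_le k)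
      have h3 : G (x k) ≤ φ 0 - m := by
        simp only [hφ] at h2 ⊢
        linarith
      rw [mem_preimage, ← EReal.coe_toReal (hxD k) (hgnebot _)]
      exact EReal.coe_le_coe_iff.2 h3
    exact ne_top_of_le_ne_top (EReal.coe_ne_top _) hmem
  have hultra : ∀ U : Ultrafilter ℕ, ↑U ≤ (atTop : Filter ℕ) → ∃ z, Tendsto x U (𝓝 z) := by
    intro U hU
    obtain ⟨z, -, hz⟩ := hS.ultrafilter_le_nhds (U.map x)
      (tendsto_principal.2 (Eventually.of_forall hxS))
    exact ⟨z, hz⟩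
  have hcont : ∀ z, g z ≠ ⊤ → ContinuousAt f z ∧ ContinuousAt f' z ∧ ContinuousAt f'' z :=
    fun z hz => ⟨(hf1 z (hOdom hz)).continuousAt, (hf2 z (hOdom hz)).continuousAt,
      hf2c.continuousAt (hO.mem_nhds (hOdom hz))⟩
  have hLbdd : ∀ U : Ultrafilter ℕ, ↑U ≤ (atTop : Filter ℕ) → ∃ M : ℝ, ∀ᶠ k in U, L k ≤ M := by
    intro U hU
    obtain ⟨z, hz⟩ := hultra U hU
    have hzD := hlimdom U hU z hz
    obtain ⟨K, hK, δ, hδ, hLip⟩ := hloc z (homegaN U hU z hz)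
    obtain ⟨hc, hc', hc''⟩ := hcont z hzD
    obtain ⟨M, hM⟩ := exists_bound_of_rejected_step (G := G) hD
      (fun c hc => hf1 c (hOdom hc)) (fun c hc => hf2 c (hOdom hc)) hc hc' hc'' hK hδ
      (fun c hc d hd => hLip c hc.2 d hd.2)
      (α := -(G (proxg 0) - ‖proxg 0‖ * ‖z - proxg 0‖)) (β := ‖proxg 0‖) (norm_nonneg _)
      (fun u hu => by
        have h1 := (hp 0).2 u hu
        rw [zero_sub, inner_neg_left] at h1
        have h2 := real_inner_le_norm (proxg 0) (u - proxg 0)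
        have h3 : ‖u - proxg 0‖ ≤ ‖u - z‖ + ‖z - proxg 0‖ := norm_sub_le_norm_sub_add_norm_sub ..
        have h4 := mul_le_mul_of_nonneg_left h3 (norm_nonneg (proxg 0))
        simp only [hG] at *
        linarith)
      hq hσ.2 (φ 0)
    refine ⟨max Lmax (τ * M), ?_⟩
    filter_upwards [hz.eventually hM] with k hk
    rcases Nat.eq_zero_or_pos (j k) with hj | hj
    · rw [hLdef, hj, pow_zero, one_mul]
      exact le_max_of_le_left (hL0 k).2
    · obtain ⟨b, hb, -, hmod, hrej⟩ := hback k hj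
      have hτ0 : 0 < τ := by linarith
      refine le_max_of_le_right ?_
      rw [← div_le_iff₀' hτ0]
      refine hk (hxD k) (hanti (Nat.zero_le k)) (L k / τ) b hb (div_pos (hLpos k) hτ0) ?_ ?_
      · rw [hΘ, hΘ, hϑ, hϑ, ← EReal.coe_toReal hb (hgnebot b),
          ← EReal.coe_toReal (hxD k) (hgnebot _)] at hmod
        have h := EReal.coe_lt_coe_iff.1 hmod
        simpa [Real.zero_rpow hq0.ne'] using h
      · rw [hFG _ (hxD k), hFG _ hb] at hrej
        exact EReal.coe_lt_coe_iff.1 hrej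
  have hvle : ∀ k, ‖v k‖ ≤ ϱ * L k * ‖y k - x k‖ ^ (q - 1) := fun k => hv k ▸ hinex1 k
  have hv0 : Tendsto v atTop (𝓝 0) := by
    refine (tendsto_iff_ultrafilter ..).2 fun U hU => ?_
    obtain ⟨M, hM⟩ := hLbdd U hU
    have hpow := ((hd.mono_left hU).rpow_const (p := q - 1)
      (Or.inr (by linarith [hq.1]))).const_mul (ϱ * M)
    rw [Real.zero_rpow (by linarith [hq.1]), mul_zero] at hpow
    refine squeeze_zero_norm' ?_ hpow
    filter_upwards [hM] with k hk
    refine (hvle k).trans ?_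
    have := hϱ.1
    gcongr
  have hr0 : Tendsto (fun k : ℕ => ‖x k - proxg (x k - f' (x k))‖) atTop (𝓝 0) := by
    refine (tendsto_iff_ultrafilter ..).2 fun U hU => ?_
    obtain ⟨M, hM⟩ := hLbdd U hU
    obtain ⟨z, hz⟩ := hultra U hU
    have hH := ((hcont z (hlimdom U hU z hz)).2.2.tendsto.comp hz).norm
    have hdU := hd.mono_left hU
    have hbound := (hdU.mul ((hH.const_add 2).add_const M)).add (hv0.norm.mono_left hU)
    rw [zero_mul, norm_zero, add_zero] at hbound
    refine squeeze_zero' (Eventually.of_forall fun k => norm_nonneg _) ?_ hbound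
    filter_upwards [hM, hdU.eventually_le_const zero_lt_one] with k hk hd1
    set w := y k - (f' (x k) + f'' (x k) (y k - x k)
      + (L k * ‖y k - x k‖ ^ (q - 2)) • (y k - x k)) with hw
    have hvk : v k = y k - proxg w := by rw [hv, hRk]
    have e : x k - proxg (x k - f' (x k))
        = -(y k - x k) + v k + (proxg w - proxg (x k - f' (x k))) := by rw [hvk]; abel
    have h1 := hproxLip w (x k - f' (x k))
    have e1 : w - (x k - f' (x k)) = (y k - x k) - f'' (x k) (y k - x k)
        - (L k * ‖y k - x k‖ ^ (q - 2)) • (y k - x k) := by rw [hw]; abel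
    have h2 : ‖(L k * ‖y k - x k‖ ^ (q - 2)) • (y k - x k)‖ ≤ M * ‖y k - x k‖ := by
      have hL0' := hLpos k
      rw [norm_smul, Real.norm_eq_abs, abs_of_nonneg (by positivity)]
      have h3 : ‖y k - x k‖ ^ (q - 2) ≤ 1 :=
        Real.rpow_le_one (norm_nonneg _) hd1 (by linarith [hq.1])
      have h4 : L k * ‖y k - x k‖ ^ (q - 2) ≤ M :=
        (mul_le_of_le_one_right hL0'.le h3).trans hk
      gcongr
    have h3 : ‖w - (x k - f' (x k))‖
        ≤ ‖y k - x k‖ + ‖f'' (x k)‖ * ‖y k - x k‖ + M * ‖y k - x k‖ := by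
      rw [e1]
      have := norm_sub_le (y k - x k - f'' (x k) (y k - x k))
        ((L k * ‖y k - x k‖ ^ (q - 2)) • (y k - x k))
      have := norm_sub_le (y k - x k) (f'' (x k) (y k - x k))
      have := (f'' (x k)).le_opNorm (y k - x k)
      linarith
    have h4 := norm_add_le (-(y k - x k) + v k) (proxg w - proxg (x k - f' (x k)))
    have h5 := norm_add_le (-(y k - x k)) (v k)
    rw [norm_neg] at h5
    rw [e]
    simp only [Function.comp_apply]
    linarith
  have hstep : Tendsto (fun k => dist (x (k + 1)) (x k)) atTop (𝓝 0) := by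
    have h := hd.add hv0.norm
    rw [norm_zero, add_zero] at h
    refine squeeze_zero (fun k => dist_nonneg) (fun k => ?_) h
    rw [dist_eq_norm, hxsucc]
    split_ifs
    · linarith [norm_nonneg (v k)]
    · rw [sub_right_comm]
      exact norm_sub_le _ _
  obtain ⟨hconn, hcomp⟩ := isConnected_mapClusterPt hS hxS hstep
  refine ⟨hv0, hr0, hconn, hcomp, fun z hz => ?_⟩
  obtain ⟨U, hU, hxz⟩ := mapClusterPt_iff_ultrafilter.1 hz
  have hzD := hlimdom U hU z hxz
  have hfix : z = proxg (z - f' z) := by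
    have h1 := (hcont z hzD).2.1.tendsto.comp hxz
    have h2 := (hxz.sub ((hproxcont.tendsto _).comp (hxz.sub h1))).norm
    exact sub_eq_zero.1 (norm_eq_zero.1 (tendsto_nhds_unique h2 (hr0.mono_left hU)))
  intro u
  by_cases hu : g u = ⊤
  · rw [hu]
    exact le_top
  have h := (hp (z - f' z)).2 u hu
  rw [← hfix, sub_sub_cancel_left] at h
  rw [← EReal.coe_toReal hu (hgnebot u), ← EReal.coe_toReal hzD (hgnebot z)]
  exact_mod_cast h
end
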